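/- Fix positive integers k and t with k ≥ 2t+3, and fix constants 0 < a ≤ b. For every function r : ℕ → ℕ satisfying a·n^{k-t-1} ≤ r(n) ≤ b·n^{k-t-1} for all sufficiently large n, there exist constants c₁, c₂ > 0 and n₀ such that for all n > n₀: c₁ · n^{2k-3t-2} ≤ ρ_{n,k,t}(C(n-t-1,k-t-1) + r(n)) ≤ c₂ · n^{2k-3t-2}. -/

import Mathlib

/-- The number of unordered pairs of distinct sets `F₁, F₂ ∈ F` with `|F₁ ∩ F₂| = t`. -/
def rhoPairs (t : ℕ) (F : Finset (Finset ℕ)) : ℕ :=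
  ((F.powersetCard 2).filter
    (fun P => ∃ A ∈ P, ∃ B ∈ P, A ≠ B ∧ (A ∩ B).card = t)).card

/-- `ρ_{n,k,t}(ℓ)`: the minimum of `ρ(F)` over families `F` of `k`-element subsets
of `[n]` with `|F| = ℓ`. -/
noncomputable def rhoMin (n k t ℓ : ℕ) : ℕ :=
  sInf { m : ℕ | ∃ F : Finset (Finset ℕ),
    F ⊆ (Finset.Icc 1 n).powersetCard k ∧ F.card = ℓ ∧ rhoPairs t F = m }

namespace JohnsonGraph

open Finset

/-- In a minimal counterexample to the Frankl–Katona lemma, the size of an edge is at most the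
degree of each of its vertices. -/
lemma card_inter_edge_le_degree {ι V : Type*} [DecidableEq ι] [DecidableEq V]
    (E : ι → Finset V) (A : Finset V)
    (ih : ∀ A' : Finset V, A' ⊆ A → #A' < #A → ∀ s : Finset ι, #s < #A' →
      ∃ I ⊆ A', I.Nonempty ∧ #{i ∈ s | I ⊆ E i} + 1 = #I)
    (s : Finset ι) (hno : ∀ I ⊆ A, I.Nonempty → #{i ∈ s | I ⊆ E i} + 1 ≠ #I)
    {i : ι} (hi : i ∈ s) {x : V} (hxA : x ∈ A) (hxi : x ∈ E i) :
    #(A ∩ E i) ≤ #{j ∈ s | x ∈ E j} := by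
  by_contra! hlt
  have hx : x ∈ A ∩ E i := mem_inter.2 ⟨hxA, hxi⟩
  have hi' : i ∈ s.filter (fun j => x ∈ E j) := mem_filter.2 ⟨hi, hxi⟩
  have hc1 : #((A ∩ E i).erase x) + 1 = #(A ∩ E i) := card_erase_add_one hx
  have hc2 : #((s.filter (fun j => x ∈ E j)).erase i) + 1 = #(s.filter (fun j => x ∈ E j)) :=
    card_erase_add_one hi'
  have hle : #(A ∩ E i) ≤ #A := card_le_card inter_subset_left
  obtain ⟨I, hI, hIne, hIc⟩ := ih ((A ∩ E i).erase x)
    ((erase_subset _ _).trans inter_subset_left) (by omega)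
    ((s.filter (fun j => x ∈ E j)).erase i) (by omega)
  have hxI : x ∉ I := fun h => by simpa using hI h
  refine hno (insert x I) ?_ (insert_nonempty _ _) ?_
  · exact insert_subset hxA (hI.trans ((erase_subset _ _).trans inter_subset_left))
  · rw [card_insert_of_notMem hxI, ← hIc]
    have : s.filter (fun j => insert x I ⊆ E j) =
        insert i (((s.filter (fun j => x ∈ E j)).erase i).filter (fun j => I ⊆ E j)) := by
      ext j
      simp only [mem_filter, mem_insert, mem_erase, insert_subset_iff]
      constructor
      · rintro ⟨h1, h2, h3⟩
        by_cases hj : j = i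
        · exact Or.inl hj
        · exact Or.inr ⟨⟨hj, h1, h2⟩, h3⟩
      · rintro (rfl | ⟨⟨-, h1, h2⟩, h3⟩)
        · exact ⟨hi, hxi, fun y hy => (mem_inter.1 (mem_of_mem_erase (hI hy))).2⟩
        · exact ⟨h1, h2, h3⟩
    rw [this, card_insert_of_notMem (by simp)]

/-- Frankl–Katona: fewer edges than vertices forces a nonempty set of codegree one less than
its size. -/
lemma exists_card_codegree_add_one_eq {ι V : Type*} [DecidableEq ι] [DecidableEq V]
    (E : ι → Finset V) (A : Finset V) (s : Finset ι) (hs : #s < #A) :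
    ∃ I ⊆ A, I.Nonempty ∧ #{i ∈ s | I ⊆ E i} + 1 = #I := by
  induction hn : #A using Nat.strong_induction_on generalizing A s with
  | _ n IH =>
  by_contra! hno
  have hsub : ∀ i ∈ s, ∀ x ∈ A, x ∈ E i → #(A ∩ E i) ≤ #{j ∈ s | x ∈ E j} := by
    intro i hi x hxA hxi
    refine card_inter_edge_le_degree E A ?_ s hno hi hxA hxi
    intro A' _ hA' s' hs'
    exact IH _ (hn ▸ hA') A' s' hs' rfl
  have hpos : ∀ x ∈ A, 0 < #{j ∈ s | x ∈ E j} := by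
    intro x hx
    have := hno {x} (by simpa using hx) (by simp)
    simp only [singleton_subset_iff, card_singleton] at this
    omega
  have h1 : (#A : ℚ) = ∑ x ∈ A, ∑ i ∈ s, if x ∈ E i then (1 / (#{j ∈ s | x ∈ E j}) : ℚ) else 0 := by
    rw [card_eq_sum_ones, Nat.cast_sum]
    refine sum_congr rfl fun x hx => ?_
    rw [← sum_filter, sum_const, nsmul_eq_mul]
    have : (0 : ℚ) < #{j ∈ s | x ∈ E j} := by exact_mod_cast hpos x hx
    field_simp
    simp
  have h2 : (#A : ℚ) ≤ #s := by
    rw [h1, sum_comm, card_eq_sum_ones s, Nat.cast_sum]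
    refine sum_le_sum fun i hi => ?_
    rw [← sum_filter, filter_mem_eq_inter]
    rcases (A ∩ E i).eq_empty_or_nonempty with he | hne
    · simp [he]
    calc ∑ x ∈ A ∩ E i, (1 / (#{j ∈ s | x ∈ E j}) : ℚ)
        ≤ ∑ x ∈ A ∩ E i, (1 / (#(A ∩ E i)) : ℚ) := by
          refine sum_le_sum fun x hx => ?_
          have hx' := mem_inter.1 hx
          have : 0 < #(A ∩ E i) := hne.card_pos
          exact one_div_le_one_div_of_le (by exact_mod_cast this)
            (by exact_mod_cast hsub i hi x hx'.1 hx'.2)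
      _ = 1 := by
          have : (0 : ℚ) < #(A ∩ E i) := by exact_mod_cast hne.card_pos
          rw [sum_const, nsmul_eq_mul]
          field_simp
      _ = _ := by simp
  have : #A ≤ #s := by exact_mod_cast h2
  omega

/-- An intersection-closed family on `F` without members of size `t`, whose proper members
cover all subsets of size `#F - t - 2`, contains all `F \ {x}` with `x` outside some
`(t+1)`-set. -/
lemma exists_erase_mem_of_inter_closed {α : Type*} [DecidableEq α] {t : ℕ} {F : Finset α}
    (hk : 2 * t + 3 ≤ #F) (𝒞 : Set (Finset α))
    (hinter : ∀ A ∈ 𝒞, ∀ B ∈ 𝒞, A ∩ B ∈ 𝒞) (hcard : ∀ A ∈ 𝒞, A ⊆ F → #A ≠ t)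
    (hcov : ∀ R ⊆ F, #R = #F - t - 2 → ∃ C ∈ 𝒞, R ⊆ C ∧ C ⊂ F) :
    ∃ T ⊆ F, #T = t + 1 ∧ ∀ x ∈ F \ T, F.erase x ∈ 𝒞 := by
  classical
  obtain ⟨R, hR, hRmin⟩ := exists_min_image
    (F.powerset.filter (fun R => ∀ C ∈ 𝒞, R ⊆ C → ¬ C ⊂ F)) card
    ⟨F, by
      simp only [mem_filter, mem_powerset, Subset.refl, true_and]
      exact fun C _ h h' => h'.2 h⟩
  simp only [mem_filter, mem_powerset] at hR hRmin
  obtain ⟨hRF, hRgen⟩ := hR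
  have hRcard : #F - t - 1 ≤ #R := by
    by_contra! hlt
    obtain ⟨R', h1, h2, h3⟩ := exists_subsuperset_card_eq hRF (n := #F - t - 2)
      (by omega) (by omega)
    obtain ⟨C, hC, hRC, hCF⟩ := hcov R' h2 h3
    exact hRgen C hC (h1.trans hRC) hCF
  have hex : ∀ r ∈ R, ∃ C ∈ 𝒞, R.erase r ⊆ C ∧ C ⊂ F := by
    intro r hr
    by_contra! hno
    have h1 := hRmin (R.erase r) ⟨(erase_subset _ _).trans hRF, hno⟩
    have h2 := card_erase_add_one hr
    omega
  choose! C hC𝒞 hRC hCF using hex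
  have hrC : ∀ r ∈ R, r ∉ C r := by
    intro r hr h
    refine hRgen (C r) (hC𝒞 r hr) ?_ (hCF r hr)
    intro x hx
    by_cases hxr : x = r
    · exact hxr ▸ h
    · exact hRC r hr (mem_erase.2 ⟨hxr, hx⟩)
  have hmeet : ∀ I : Finset α, I.Nonempty → I ⊆ R → F.filter (fun x => ∀ r ∈ I, x ∈ C r) ∈ 𝒞 := by
    intro I hI
    induction hI using Finset.Nonempty.cons_induction with
    | singleton r =>
      intro h
      have hr : r ∈ R := by simpa using h
      have : F.filter (fun x => ∀ r' ∈ ({r} : Finset α), x ∈ C r') = C r := by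
        ext x
        simp only [mem_filter, mem_singleton, forall_eq]
        exact ⟨fun h => h.2, fun h => ⟨(hCF r hr).1 h, h⟩⟩
      rw [this]
      exact hC𝒞 r hr
    | cons r I hrI hI ih =>
      intro h
      have hr : r ∈ R := h (mem_cons_self _ _)
      have hIR : I ⊆ R := fun x hx => h (mem_cons_of_mem hx)
      have : F.filter (fun x => ∀ r' ∈ cons r I hrI, x ∈ C r') =
          C r ∩ F.filter (fun x => ∀ r ∈ I, x ∈ C r) := by
        ext x
        simp only [mem_filter, mem_cons, forall_eq_or_imp, mem_inter]
        tauto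
      rw [this]
      exact hinter _ (hC𝒞 r hr) _ (ih hIR)
  set P := F \ R with hP
  have hPc : #P + #R = #F := card_sdiff_add_card_eq_card hRF
  have hsize : ∀ I : Finset α, I.Nonempty → I ⊆ R →
      #(P.filter (fun x => ∀ r ∈ I, x ∈ C r)) + #R ≠ t + #I := by
    intro I hI hIR heq
    have hdecomp : F.filter (fun x => ∀ r ∈ I, x ∈ C r) =
        (R \ I) ∪ P.filter (fun x => ∀ r ∈ I, x ∈ C r) := by
      ext x
      simp only [mem_filter, mem_union, mem_sdiff, hP]
      constructor
      · rintro ⟨hxF, hx⟩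
        by_cases hxR : x ∈ R
        · exact Or.inl ⟨hxR, fun hxI => hrC x hxR (hx x hxI)⟩
        · exact Or.inr ⟨⟨hxF, hxR⟩, hx⟩
      · rintro (⟨hxR, hxI⟩ | ⟨⟨hxF, hxR⟩, hx⟩)
        · refine ⟨hRF hxR, fun r hr => hRC r (hIR hr) (mem_erase.2 ⟨?_, hxR⟩)⟩
          rintro rfl
          exact hxI hr
        · exact ⟨hxF, hx⟩
    have hdisj : Disjoint (R \ I) (P.filter (fun x => ∀ r ∈ I, x ∈ C r)) := by
      rw [disjoint_left]
      intro x hx hx'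
      exact (mem_sdiff.1 (mem_filter.1 hx').1).2 (mem_sdiff.1 hx).1
    have h1 := hcard _ (hmeet I hI hIR) (filter_subset _ _)
    rw [hdecomp, card_union_of_disjoint hdisj] at h1
    have h2 : #(R \ I) + #I = #R := card_sdiff_add_card_eq_card hIR
    omega
  let E : α ⊕ ℕ → Finset α := Sum.elim (fun x => R.filter (fun r => x ∈ C r)) (fun _ => R)
  let s : Finset (α ⊕ ℕ) := P.disjSum (range (#R - t - 1))
  have hscard : #s = #P + (#R - t - 1) := by simp [s]
  have hdeg : ∀ I : Finset α, I ⊆ R → #{i ∈ s | I ⊆ E i} =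
      #(P.filter (fun x => ∀ r ∈ I, x ∈ C r)) + (#R - t - 1) := by
    intro I hIR
    have : s.filter (fun i => I ⊆ E i) =
        (P.filter (fun x => ∀ r ∈ I, x ∈ C r)).disjSum (range (#R - t - 1)) := by
      ext i
      rcases i with x | j
      · simp only [s, E, mem_filter, inl_mem_disjSum, Sum.elim_inl, subset_iff]
        constructor
        · exact fun h => ⟨h.1, fun r hr => (h.2 hr).2⟩
        · exact fun h => ⟨h.1, fun r hr => ⟨hIR hr, h.2 r hr⟩⟩
      · simp [s, E, hIR]
    rw [this, card_disjSum, card_range]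
  have hno : ∀ I ⊆ R, I.Nonempty → #{i ∈ s | I ⊆ E i} + 1 ≠ #I := by
    intro I hIR hI
    rw [hdeg I hIR]
    have := hsize I hI hIR
    omega
  have hnlt : ¬ #s < #R := by
    intro hlt
    obtain ⟨I, h1, h2, h3⟩ := exists_card_codegree_add_one_eq E R s hlt
    exact hno I h1 h2 h3
  have hPt : #P = t + 1 := by omega
  refine ⟨P, sdiff_subset, hPt, ?_⟩
  intro r hr
  have hr' : r ∈ R := by
    rw [hP] at hr
    simp only [mem_sdiff, not_and, not_not] at hr
    exact hr.2 hr.1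
  have hfull : #(R ∩ E (Sum.inr 0)) ≤ #{j ∈ s | r ∈ E j} := by
    refine card_inter_edge_le_degree E R ?_ s hno ?_ hr' hr'
    · intro A' _ _ s' hs'
      exact exists_card_codegree_add_one_eq E A' s' hs'
    · simp only [s, inr_mem_disjSum, mem_range]
      omega
  have heq : s.filter (fun j => r ∈ E j) = s := by
    refine eq_of_subset_of_card_le (filter_subset _ _) ?_
    have : R ∩ E (Sum.inr 0) = R := by simp [E]
    rw [this] at hfull
    omega
  have hPC : ∀ x ∈ P, x ∈ C r := by
    intro x hx
    have h1 : (Sum.inl x : α ⊕ ℕ) ∈ s := by simpa [s] using hx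
    rw [← heq] at h1
    exact (mem_filter.1 (mem_filter.1 h1).2).2
  have : F.erase r = C r := by
    ext x
    rw [mem_erase]
    constructor
    · rintro ⟨hxr, hxF⟩
      by_cases hxR : x ∈ R
      · exact hRC r hr' (mem_erase.2 ⟨hxr, hxR⟩)
      · exact hPC x (mem_sdiff.2 ⟨hxF, hxR⟩)
    · intro hx
      exact ⟨fun h => hrC r hr' (h ▸ hx), (hCF r hr').1 hx⟩
  rw [this]
  exact hC𝒞 r hr'

/-- One-step extensions of `X` by an element of `N S` for some `t`-subset `S` of `X`. -/
def extensions {α : Type*} [DecidableEq α] (t : ℕ) (N : Finset α → Finset α) (X : Finset α) :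
    Finset (Finset α) :=
  (X.powersetCard t).biUnion fun S => (N S).image fun x => insert x X

/-- Sets obtained from `R` by `i` successive one-step extensions. -/
def reach {α : Type*} [DecidableEq α] (t : ℕ) (N : Finset α → Finset α) :
    ℕ → Finset α → Finset (Finset α)
  | 0, R => {R}
  | i + 1, R => (reach t N i R).biUnion (extensions t N)

lemma mem_extensions {α : Type*} [DecidableEq α] {t : ℕ} {N : Finset α → Finset α}
    {X Y : Finset α} :
    Y ∈ extensions t N X ↔ ∃ S ⊆ X, #S = t ∧ ∃ x ∈ N S, insert x X = Y := by
  simp only [extensions, mem_biUnion, mem_powersetCard, mem_image, and_assoc]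

lemma card_le_of_mem_reach {α : Type*} [DecidableEq α] {t : ℕ} {N : Finset α → Finset α} {i : ℕ}
    {R X : Finset α} (h : X ∈ reach t N i R) : #X ≤ #R + i := by
  induction i generalizing X with
  | zero => simp only [reach, mem_singleton] at h; simp [h]
  | succ i ih =>
    simp only [reach, mem_biUnion] at h
    obtain ⟨Y, hY, hX⟩ := h
    obtain ⟨S, -, -, x, -, rfl⟩ := mem_extensions.1 hX
    have := ih hY
    have := card_insert_le x Y
    omega

lemma card_reach_le {α : Type*} [DecidableEq α] {t C : ℕ} {N : Finset α → Finset α}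
    (hN : ∀ S, #(N S) ≤ C) (i : ℕ) (R : Finset α) :
    #(reach t N i R) ≤ (2 ^ (#R + i) * C) ^ i := by
  induction i with
  | zero => simp [reach]
  | succ i ih =>
    have hext : ∀ X ∈ reach t N i R, #(extensions t N X) ≤ 2 ^ (#R + i) * C := by
      intro X hX
      calc #(extensions t N X) ≤ ∑ S ∈ X.powersetCard t, #((N S).image fun x => insert x X) :=
            card_biUnion_le
        _ ≤ ∑ S ∈ X.powersetCard t, C := sum_le_sum fun S _ => card_image_le.trans (hN S)
        _ = (#X).choose t * C := by simp
        _ ≤ 2 ^ (#R + i) * C := by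
          refine Nat.mul_le_mul_right _ ((Nat.choose_le_two_pow _ _).trans ?_)
          exact Nat.pow_le_pow_right (by norm_num) (card_le_of_mem_reach hX)
    calc #(reach t N (i + 1) R) ≤ ∑ X ∈ reach t N i R, #(extensions t N X) := card_biUnion_le
      _ ≤ ∑ X ∈ reach t N i R, 2 ^ (#R + i) * C := sum_le_sum hext
      _ = #(reach t N i R) * (2 ^ (#R + i) * C) := by simp
      _ ≤ (2 ^ (#R + i) * C) ^ i * (2 ^ (#R + i) * C) := Nat.mul_le_mul_right _ ih
      _ = (2 ^ (#R + i) * C) ^ (i + 1) := (pow_succ _ _).symm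
      _ ≤ (2 ^ (#R + (i + 1)) * C) ^ (i + 1) := by
        refine Nat.pow_le_pow_left (Nat.mul_le_mul_right _ ?_) _
        exact Nat.pow_le_pow_right (by norm_num) (by omega)

lemma mem_reach_of_forall_exists {α : Type*} [DecidableEq α] {t : ℕ} {N : Finset α → Finset α}
    {R Y : Finset α} (hRY : R ⊆ Y)
    (h : ∀ X, R ⊆ X → X ⊂ Y → ∃ S ⊆ X, #S = t ∧ ∃ x ∈ N S, x ∈ Y ∧ x ∉ X) :
    Y ∈ reach t N (#Y - #R) R := by
  have key : ∀ i ≤ #Y - #R, ∃ X ∈ reach t N i R, R ⊆ X ∧ X ⊆ Y ∧ #X = #R + i := by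
    intro i
    induction i with
    | zero => exact fun _ => ⟨R, by simp [reach], Subset.refl _, hRY, rfl⟩
    | succ i ih =>
      intro hi
      obtain ⟨X, hX, hRX, hXY, hXc⟩ := ih (by omega)
      have hss : X ⊂ Y := hXY.ssubset_of_ne (by rintro rfl; omega)
      obtain ⟨S, hSX, hS, x, hx, hxY, hxX⟩ := h X hRX hss
      refine ⟨insert x X, ?_, hRX.trans (subset_insert _ _), insert_subset hxY hXY, ?_⟩
      · simp only [reach, mem_biUnion]
        exact ⟨X, hX, mem_extensions.2 ⟨S, hSX, hS, x, hx, rfl⟩⟩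
      · rw [card_insert_of_notMem hxX, hXc]; rfl
  obtain ⟨X, hX, -, hXY, hXc⟩ := key _ le_rfl
  have := card_le_card hRY
  rwa [eq_of_subset_of_card_le hXY (by omega)] at hX

/-- If every `t`-subset of `F` has an out-neighbour in `F` and no small subset of `F` reaches `F`,
then there is a kernel `T` of size `t + 1` reached from every `t`-subset of `F \ T`. -/
lemma exists_kernel {α : Type*} [DecidableEq α] {t : ℕ} {N : Finset α → Finset α}
    {F : Finset α} (hk : 2 * t + 3 ≤ #F)
    (hout : ∀ S ⊆ F, #S = t → ∃ x ∈ N S, x ∈ F ∧ x ∉ S)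
    (hgen : ∀ R ⊆ F, #R = #F - t - 2 → F ∉ reach t N (t + 2) R) :
    ∃ T ⊆ F, #T = t + 1 ∧ ∀ S ⊆ F \ T, #S = t → S ∪ T ∈ reach t N (t + 1) S := by
  have hcore : ∃ T ⊆ F, #T = t + 1 ∧ ∀ x ∈ F \ T, F.erase x ∈
      {C : Finset α | ∀ S ⊆ C, #S = t → ∀ x ∈ N S, x ∈ F → x ∈ C} := by
    refine exists_erase_mem_of_inter_closed hk _ ?_ ?_ ?_
    · intro A hA B hB S hS hSt x hx hxF
      exact mem_inter.2 ⟨hA S (hS.trans inter_subset_left) hSt x hx hxF,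
        hB S (hS.trans inter_subset_right) hSt x hx hxF⟩
    · intro A hA hAF hAt
      obtain ⟨x, hx, hxF, hxA⟩ := hout A hAF hAt
      exact hxA (hA A Subset.rfl hAt x hx hxF)
    · intro R hRF hRc
      by_contra! hno
      refine hgen R hRF hRc ?_
      have hc : #F - #R = t + 2 := by omega
      rw [← hc]
      refine mem_reach_of_forall_exists hRF fun X hRX hXF => ?_
      by_contra! hX
      refine hno X ?_ hRX hXF
      intro S hS hSt x hx hxF
      by_contra hxX
      exact hxX (hX S hS hSt x hx hxF)
  obtain ⟨T, hTF, hTc, hT⟩ := hcore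
  refine ⟨T, hTF, hTc, ?_⟩
  have hNT : ∀ S ⊆ F, #S = t → ∀ x ∈ N S, x ∈ F → x ∉ S → x ∈ T := by
    intro S hS hSt x hx hxF hxS
    by_contra hxT
    have := hT x (mem_sdiff.2 ⟨hxF, hxT⟩) S (subset_erase.2 ⟨hS, hxS⟩) hSt x hx hxF
    simp at this
  intro S hS hSt
  have hdisj : Disjoint S T := by
    rw [disjoint_left]
    exact fun x hx => (mem_sdiff.1 (hS hx)).2
  have hc : #(S ∪ T) - #S = t + 1 := by rw [card_union_of_disjoint hdisj]; omega
  have hSF : S ⊆ F := hS.trans sdiff_subset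
  have := mem_reach_of_forall_exists (t := t) (N := N) (R := S) (Y := S ∪ T)
    subset_union_left ?_
  · rwa [hc] at this
  · intro X hSX hX
    have hXT : #(X ∩ T) ≤ t := by
      by_contra! hlt
      have : X ∩ T = T := eq_of_subset_of_card_le inter_subset_right (by omega)
      exact hX.2 (union_subset hSX (inter_eq_right.1 this))
    have hXF : X ⊆ F := hX.1.trans (union_subset hSF hTF)
    obtain ⟨S', h1, h2, h3⟩ := exists_subsuperset_card_eq (inter_subset_left : X ∩ T ⊆ X) hXT
      (hSt ▸ card_le_card hSX)
    obtain ⟨x, hx, hxF, hxS⟩ := hout S' (h2.trans hXF) h3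
    have hxT := hNT S' (h2.trans hXF) h3 x hx hxF hxS
    exact ⟨S', h2, h3, x, hx, mem_union_right _ hxT, fun hxX => hxS (h1 (mem_inter.2 ⟨hxX, hxT⟩))⟩

open scoped FinsetFamily in
/-- Lovász's form of the Kruskal–Katona theorem for families of finite sets of naturals. -/
lemma choose_le_card_biUnion_powersetCard {m q r t : ℕ} (htr : t ≤ r) (hrq : r ≤ q) (hqm : q ≤ m)
    {𝒜 : Finset (Finset ℕ)} (h𝒜 : ∀ A ∈ 𝒜, A ⊆ range m ∧ #A = r) (hc : q.choose r ≤ #𝒜) :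
    q.choose t ≤ #(𝒜.biUnion (powersetCard t)) := by
  let ℬ : Finset (Finset (Fin m)) :=
    univ.filter (fun B => B.map Fin.valEmbedding ∈ 𝒜)
  have hmapB : ∀ A ∈ 𝒜, ∃ B ∈ ℬ, B.map Fin.valEmbedding = A := by
    intro A hA
    have : (univ.filter (fun x : Fin m => (x : ℕ) ∈ A)).map Fin.valEmbedding = A := by
      ext x
      simp only [mem_map, mem_filter, mem_univ, true_and, Fin.valEmbedding_apply]
      constructor
      · rintro ⟨y, hy, rfl⟩; exact hy
      · exact fun hx => ⟨⟨x, mem_range.1 ((h𝒜 A hA).1 hx)⟩, hx, rfl⟩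
    exact ⟨_, by simp only [ℬ, mem_filter, mem_univ, true_and, this, hA], this⟩
  have hcard : #𝒜 ≤ #ℬ := by
    refine card_le_card_of_surjOn (fun B => B.map Fin.valEmbedding) ?_
    intro A hA
    obtain ⟨B, hB, hBA⟩ := hmapB A hA
    exact ⟨B, hB, hBA⟩
  have hsized : (ℬ : Set (Finset (Fin m))).Sized r := by
    intro B hB
    have := (h𝒜 _ (mem_filter.1 (mem_coe.1 hB)).2).2
    simpa using this
  have hkk := kruskal_katona_lovasz_form (i := r - t) (by omega) hrq hqm hsized (hc.trans hcard)
  rw [Nat.sub_sub_self htr] at hkk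
  refine hkk.trans ?_
  refine card_le_card_of_injOn (fun B => B.map Fin.valEmbedding) ?_ ?_
  · intro B hB
    obtain ⟨A, hA, hBA, hAc⟩ := mem_shadow_iterate_iff_exists_mem_card_add.1 (mem_coe.1 hB)
    refine mem_coe.2 (mem_biUnion.2 ⟨A.map Fin.valEmbedding, (mem_filter.1 hA).2, ?_⟩)
    rw [mem_powersetCard]
    refine ⟨map_subset_map.2 hBA, ?_⟩
    have := hsized (mem_coe.2 hA)
    rw [card_map]
    omega
  · intro B _ B' _ h
    exact map_injective _ h

lemma choose_succ_le_mul_choose {q r : ℕ} (h : r ≤ q) :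
    (q + 1).choose r ≤ (r + 1) * q.choose r := by
  have h1 := Nat.choose_mul_succ_eq q r
  obtain ⟨d, rfl⟩ := Nat.exists_eq_add_of_le h
  have h2 : r + d + 1 - r = d + 1 := by omega
  rw [h2] at h1
  have h3 : (r + d + 1).choose r * (d + 1) ≤ ((r + 1) * (r + d).choose r) * (d + 1) := by
    rw [← h1]
    have : r + d + 1 ≤ (r + 1) * (d + 1) := by nlinarith [Nat.zero_le (r * d)]
    calc (r + d).choose r * (r + d + 1) ≤ (r + d).choose r * ((r + 1) * (d + 1)) :=
          Nat.mul_le_mul_left _ this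
      _ = _ := by ring
  exact Nat.le_of_mul_le_mul_right h3 (by omega)

lemma choose_le_choose_mul_pow {q r t : ℕ} (htr : t ≤ r) :
    q.choose r ≤ q.choose t * q ^ (r - t) := by
  have h1 := Nat.choose_mul htr (n := q)
  have h2 : 1 ≤ r.choose t := Nat.choose_pos htr
  calc q.choose r ≤ q.choose r * r.choose t := Nat.le_mul_of_pos_right _ h2
    _ = q.choose t * (q - t).choose (r - t) := h1
    _ ≤ q.choose t * q ^ (r - t) := by
      refine Nat.mul_le_mul_left _ ((Nat.choose_le_pow _ _).trans ?_)
      exact Nat.pow_le_pow_left (Nat.sub_le _ _) _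

lemma card_le_of_card_le_choose {m q r t : ℕ} (htr : t ≤ r) (hrq : r ≤ q) (hqm : q ≤ m)
    {𝒜 : Finset (Finset ℕ)} (h𝒜 : ∀ A ∈ 𝒜, A ⊆ range m ∧ #A = r) (hc : #𝒜 ≤ q.choose r) :
    #𝒜 ≤ (r + 1) * q ^ (r - t) * #(𝒜.biUnion (powersetCard t)) := by
  rcases 𝒜.eq_empty_or_nonempty with rfl | hne
  · simp
  let q' := Nat.findGreatest (fun x => r ≤ x ∧ x.choose r ≤ #𝒜) q
  have hbase : r ≤ r ∧ r.choose r ≤ #𝒜 := ⟨le_rfl, by simpa using hne.card_pos⟩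
  obtain ⟨hrq', hq'c⟩ : r ≤ q' ∧ q'.choose r ≤ #𝒜 :=
    Nat.findGreatest_spec (P := fun x => r ≤ x ∧ x.choose r ≤ #𝒜) hrq hbase
  have hq'q : q' ≤ q := Nat.findGreatest_le q
  have hup : #𝒜 ≤ (q' + 1).choose r := by
    by_contra! hlt
    rcases hq'q.eq_or_lt with heq | hlt'
    · have := hc.trans (Nat.choose_le_choose r (Nat.le_succ q))
      rw [heq] at hlt
      exact absurd this (not_le.2 hlt)
    · have := Nat.findGreatest_is_greatest (P := fun x => r ≤ x ∧ x.choose r ≤ #𝒜)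
        (n := q) (k := q' + 1) (Nat.lt_succ_self _) hlt'
      exact this ⟨by omega, hlt.le⟩
  have hkk := choose_le_card_biUnion_powersetCard htr hrq' (hq'q.trans hqm) h𝒜 hq'c
  calc #𝒜 ≤ (q' + 1).choose r := hup
    _ ≤ (r + 1) * q'.choose r := choose_succ_le_mul_choose hrq'
    _ ≤ (r + 1) * (q'.choose t * q' ^ (r - t)) :=
      Nat.mul_le_mul_left _ (choose_le_choose_mul_pow htr)
    _ = (r + 1) * q' ^ (r - t) * q'.choose t := by ring
    _ ≤ (r + 1) * q ^ (r - t) * #(𝒜.biUnion (powersetCard t)) :=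
      Nat.mul_le_mul (Nat.mul_le_mul_left _ (Nat.pow_le_pow_left hq'q _)) hkk

/-- If each `t`-set belongs to few sets `F \ τ F` up to the choice of `τ F`, and no kernel is
shared by many sets, then the family is small. -/
lemma card_le_of_kernel {n k t q C : ℕ} (htk : 2 * t + 1 ≤ k) (hrq : k - t - 1 ≤ q) (hqn : q ≤ n)
    {G : Finset (Finset ℕ)} (hG : G ⊆ (Icc 1 n).powersetCard k) (τ : Finset ℕ → Finset ℕ)
    (hτ : ∀ F ∈ G, τ F ⊆ F ∧ #(τ F) = t + 1)
    (hC : ∀ S, #S = t → #((G.image τ).filter fun T => ∃ F ∈ G, τ F = T ∧ S ⊆ F \ T) ≤ C)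
    (hq : ∀ T, #(G.filter fun F => τ F = T) ≤ q.choose (k - t - 1)) :
    #G ≤ (k - t) * q ^ (k - 2 * t - 1) * (C * n ^ t) := by
  let 𝒜 : Finset ℕ → Finset (Finset ℕ) := fun T => (G.filter fun F => τ F = T).image (· \ T)
  have h𝒜c : ∀ T, #(𝒜 T) = #(G.filter fun F => τ F = T) := by
    intro T
    refine card_image_of_injOn ?_
    intro F hF F' hF' h
    simp only [coe_filter, Set.mem_ofPred_eq] at hF hF' h
    have h1 : T ⊆ F := hF.2 ▸ (hτ F hF.1).1
    have h2 : T ⊆ F' := hF'.2 ▸ (hτ F' hF'.1).1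
    rw [← sdiff_union_of_subset h1, h, sdiff_union_of_subset h2]
  have hGc : #G = ∑ T ∈ G.image τ, #(𝒜 T) := by
    simp_rw [h𝒜c]
    exact card_eq_sum_card_image τ G
  have hbound : ∀ T ∈ G.image τ, #(𝒜 T) ≤
      (k - t) * q ^ (k - 2 * t - 1) * #((𝒜 T).biUnion (powersetCard t)) := by
    intro T _
    have := card_le_of_card_le_choose (m := n + 1) (q := q) (r := k - t - 1) (t := t)
      (𝒜 := 𝒜 T) (by omega) hrq (by omega) ?_ (by rw [h𝒜c]; exact hq T)
    · have e1 : k - t - 1 + 1 = k - t := by omega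
      have e2 : k - t - 1 - t = k - 2 * t - 1 := by omega
      rwa [e1, e2] at this
    · intro A hA
      obtain ⟨F, hF, rfl⟩ := mem_image.1 hA
      obtain ⟨hFG, rfl⟩ := mem_filter.1 hF
      have h1 := mem_powersetCard.1 (hG hFG)
      have h2 := hτ F hFG
      refine ⟨?_, ?_⟩
      · intro x hx
        have := mem_Icc.1 (h1.1 (mem_sdiff.1 hx).1)
        rw [mem_range]; omega
      · have := card_sdiff_add_card_eq_card h2.1
        omega
  have hdouble : ∑ T ∈ G.image τ, #((𝒜 T).biUnion (powersetCard t)) ≤ C * n ^ t := by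
    have hsub : ∀ T, (𝒜 T).biUnion (powersetCard t) =
        ((Icc 1 n).powersetCard t).filter (fun S => ∃ F ∈ G, τ F = T ∧ S ⊆ F \ T) := by
      intro T
      ext S
      simp only [𝒜, mem_biUnion, mem_image, mem_filter, mem_powersetCard]
      constructor
      · rintro ⟨_, ⟨F, ⟨hF, hFT⟩, rfl⟩, hS, hSt⟩
        have h1 := mem_powersetCard.1 (hG hF)
        exact ⟨⟨hS.trans (sdiff_subset.trans h1.1), hSt⟩, F, hF, hFT, hS⟩
      · rintro ⟨⟨-, hSt⟩, F, hF, hFT, hS⟩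
        exact ⟨_, ⟨F, ⟨hF, hFT⟩, rfl⟩, hS, hSt⟩
    simp_rw [hsub, card_filter]
    rw [sum_comm]
    calc _ ≤ ∑ S ∈ (Icc 1 n).powersetCard t, C := by
          refine sum_le_sum fun S hS => ?_
          rw [← card_filter]
          exact hC S (mem_powersetCard.1 hS).2
      _ = n.choose t * C := by simp
      _ ≤ C * n ^ t := by
        rw [mul_comm]
        exact Nat.mul_le_mul_left _ (Nat.choose_le_pow _ _)
  calc #G ≤ ∑ T ∈ G.image τ,
        (k - t) * q ^ (k - 2 * t - 1) * #((𝒜 T).biUnion (powersetCard t)) :=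
        hGc.le.trans (sum_le_sum hbound)
    _ = (k - t) * q ^ (k - 2 * t - 1) * ∑ T ∈ G.image τ, #((𝒜 T).biUnion (powersetCard t)) :=
        (mul_sum _ _ _).symm
    _ ≤ _ := Nat.mul_le_mul_left _ hdouble

/-- The number of members of `G` containing `S`. -/
def codegree {α : Type*} [DecidableEq α] (G : Finset (Finset α)) (S : Finset α) : ℕ :=
  #(G.filter fun F => S ⊆ F)

/-- The number of members of `G` meeting `F` in exactly `t` elements. -/
def meetDegree {α : Type*} [DecidableEq α] (t : ℕ) (G : Finset (Finset α)) (F : Finset α) : ℕ :=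
  #(G.filter fun F' => #(F ∩ F') = t)

/-- The points whose addition to `S` keeps a `1 / (2 * k)` fraction of the codegree. -/
def heavyNeighbors {α : Type*} [DecidableEq α] (V : Finset α) (G : Finset (Finset α)) (k : ℕ)
    (S : Finset α) : Finset α :=
  V.filter fun x => x ∉ S ∧ 0 < codegree G S ∧ codegree G S ≤ 2 * k * codegree G (insert x S)

lemma codegree_mono {α : Type*} [DecidableEq α] {G G' : Finset (Finset α)} (h : G ⊆ G')
    (S : Finset α) : codegree G S ≤ codegree G' S :=
  card_le_card (filter_subset_filter _ h)

lemma meetDegree_mono {α : Type*} [DecidableEq α] {t : ℕ} {G G' : Finset (Finset α)} (h : G ⊆ G')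
    (F : Finset α) : meetDegree t G F ≤ meetDegree t G' F :=
  card_le_card (filter_subset_filter _ h)

lemma card_heavyNeighbors_le {α : Type*} [DecidableEq α] {V : Finset α} {G : Finset (Finset α)}
    {k : ℕ} (hG : ∀ F ∈ G, #F = k) (S : Finset α) : #(heavyNeighbors V G k S) ≤ 2 * k * k := by
  rcases Nat.eq_zero_or_pos (codegree G S) with h0 | hpos
  · have : heavyNeighbors V G k S = ∅ := by
      rw [heavyNeighbors, filter_eq_empty_iff]
      intro x _ h
      omega
    simp [this]
  have hsum : ∑ x ∈ heavyNeighbors V G k S, codegree G (insert x S) ≤ k * codegree G S := by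
    have h1 : ∀ x, codegree G (insert x S) =
        ∑ F ∈ G.filter (fun F => S ⊆ F), if x ∈ F then 1 else 0 := by
      intro x
      rw [codegree, ← card_filter, filter_filter]
      congr 1
      ext F
      simp only [mem_filter, insert_subset_iff]
      tauto
    simp_rw [h1]
    rw [sum_comm]
    calc _ ≤ ∑ F ∈ G.filter (fun F => S ⊆ F), k := by
          refine sum_le_sum fun F hF => ?_
          rw [← card_filter, ← hG F (mem_filter.1 hF).1]
          exact card_le_card fun x hx => (mem_filter.1 hx).2
      _ = k * codegree G S := by rw [sum_const, smul_eq_mul, mul_comm]; rfl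
  have h2 : #(heavyNeighbors V G k S) * codegree G S ≤ 2 * k * k * codegree G S := by
    calc #(heavyNeighbors V G k S) * codegree G S
        = ∑ x ∈ heavyNeighbors V G k S, codegree G S := by simp
      _ ≤ ∑ x ∈ heavyNeighbors V G k S, 2 * k * codegree G (insert x S) :=
        sum_le_sum fun x hx => (mem_filter.1 hx).2.2.2
      _ = 2 * k * ∑ x ∈ heavyNeighbors V G k S, codegree G (insert x S) := (mul_sum _ _ _).symm
      _ ≤ 2 * k * (k * codegree G S) := Nat.mul_le_mul_left _ hsum
      _ = _ := by ring
  exact Nat.le_of_mul_le_mul_right h2 hpos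

lemma codegree_le_meetDegree_add_sum {α : Type*} [DecidableEq α] {t : ℕ}
    {G : Finset (Finset α)} {F S : Finset α} (hSF : S ⊆ F) (hSt : #S = t) :
    codegree G S ≤ meetDegree t G F + ∑ x ∈ F \ S, codegree G (insert x S) := by
  have hsub : G.filter (fun F' => S ⊆ F') ⊆ G.filter (fun F' => #(F ∩ F') = t) ∪
      (F \ S).biUnion (fun x => G.filter fun F' => insert x S ⊆ F') := by
    intro F' hF'
    obtain ⟨hF'G, hSF'⟩ := mem_filter.1 hF'
    have hS : S ⊆ F ∩ F' := subset_inter hSF hSF'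
    rw [mem_union]
    by_cases heq : F ∩ F' ⊆ S
    · left
      rw [mem_filter, (heq.antisymm hS : F ∩ F' = S)]
      exact ⟨hF'G, hSt⟩
    · right
      obtain ⟨x, hx, hxS⟩ := not_subset.1 heq
      obtain ⟨hxF, hxF'⟩ := mem_inter.1 hx
      exact mem_biUnion.2 ⟨x, mem_sdiff.2 ⟨hxF, hxS⟩,
        mem_filter.2 ⟨hF'G, insert_subset hxF' hSF'⟩⟩
  refine (card_le_card hsub).trans ((card_union_le _ _).trans ?_)
  exact Nat.add_le_add_left card_biUnion_le _

lemma exists_mem_heavyNeighbors {α : Type*} [DecidableEq α] {V : Finset α}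
    {G : Finset (Finset α)} {k t : ℕ} (hk : 0 < k) {F S : Finset α} (hFV : F ⊆ V) (hFk : #F = k)
    (hSF : S ⊆ F) (hSt : #S = t) (hdeg : 2 * meetDegree t G F < codegree G S) :
    ∃ x ∈ heavyNeighbors V G k S, x ∈ F ∧ x ∉ S := by
  by_contra! hno
  have hlight : ∀ x ∈ F \ S, 2 * k * codegree G (insert x S) ≤ codegree G S := by
    intro x hx
    obtain ⟨hxF, hxS⟩ := mem_sdiff.1 hx
    by_contra! hlt
    refine hxS (hno x ?_ hxF)
    exact mem_filter.2 ⟨hFV hxF, hxS, by omega, hlt.le⟩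
  have hsplit := codegree_le_meetDegree_add_sum (G := G) hSF hSt
  have hsum : 2 * k * ∑ x ∈ F \ S, codegree G (insert x S) ≤ k * codegree G S := by
    rw [mul_sum]
    calc _ ≤ ∑ x ∈ F \ S, codegree G S := sum_le_sum hlight
      _ = #(F \ S) * codegree G S := by simp
      _ ≤ k * codegree G S :=
        Nat.mul_le_mul_right _ (hFk ▸ card_le_card sdiff_subset)
  have h1 := Nat.mul_le_mul_left (2 * k) hsplit
  have h2 := Nat.mul_lt_mul_of_pos_left hdeg hk
  nlinarith

lemma card_filter_exists_codegree_lt_le {n k m : ℕ} {G : Finset (Finset ℕ)}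
    (hG : G ⊆ (Icc 1 n).powersetCard k) {D : ℝ} (hD : 0 ≤ D) :
    (#(G.filter fun F => ∃ S ⊆ F, #S = m ∧ (codegree G S : ℝ) < D) : ℝ) ≤ n ^ m * D := by
  classical
  have hsub : (G.filter fun F => ∃ S ⊆ F, #S = m ∧ (codegree G S : ℝ) < D) ⊆
      (((Icc 1 n).powersetCard m).filter fun S => (codegree G S : ℝ) < D).biUnion
        fun S => G.filter fun F => S ⊆ F := by
    intro F hF
    obtain ⟨hFG, S, hSF, hS, hSD⟩ := mem_filter.1 hF
    have h1 := mem_powersetCard.1 (hG hFG)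
    exact mem_biUnion.2 ⟨S, mem_filter.2 ⟨mem_powersetCard.2 ⟨hSF.trans h1.1, hS⟩, hSD⟩,
      mem_filter.2 ⟨hFG, hSF⟩⟩
  have h1 := (card_le_card hsub).trans card_biUnion_le
  have h2 : (#(((Icc 1 n).powersetCard m).filter fun S => (codegree G S : ℝ) < D) : ℝ) ≤ n ^ m := by
    have : #(((Icc 1 n).powersetCard m).filter fun S => (codegree G S : ℝ) < D) ≤ n ^ m := by
      refine (card_filter_le _ _).trans ?_
      rw [card_powersetCard, Nat.card_Icc, Nat.add_sub_cancel]
      exact Nat.choose_le_pow _ _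
    exact_mod_cast this
  calc (#(G.filter fun F => ∃ S ⊆ F, #S = m ∧ (codegree G S : ℝ) < D) : ℝ)
      ≤ ∑ S ∈ ((Icc 1 n).powersetCard m).filter (fun S => (codegree G S : ℝ) < D),
        (codegree G S : ℝ) := by exact_mod_cast h1
    _ ≤ ∑ S ∈ ((Icc 1 n).powersetCard m).filter (fun S => (codegree G S : ℝ) < D), D :=
      sum_le_sum fun S hS => (mem_filter.1 hS).2.le
    _ = #(((Icc 1 n).powersetCard m).filter fun S => (codegree G S : ℝ) < D) * D := by simp
    _ ≤ n ^ m * D := mul_le_mul_of_nonneg_right h2 hD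

lemma card_filter_exists_reach_le {n k m t i C : ℕ} {G : Finset (Finset ℕ)}
    (hG : G ⊆ (Icc 1 n).powersetCard k) {N : Finset ℕ → Finset ℕ} (hN : ∀ S, #(N S) ≤ C) :
    #(G.filter fun F => ∃ R ⊆ F, #R = m ∧ F ∈ reach t N i R) ≤ n ^ m * (2 ^ (m + i) * C) ^ i := by
  have hsub : (G.filter fun F => ∃ R ⊆ F, #R = m ∧ F ∈ reach t N i R) ⊆
      ((Icc 1 n).powersetCard m).biUnion (reach t N i) := by
    intro F hF
    obtain ⟨hFG, R, hRF, hR, hFR⟩ := mem_filter.1 hF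
    have h1 := mem_powersetCard.1 (hG hFG)
    exact mem_biUnion.2 ⟨R, mem_powersetCard.2 ⟨hRF.trans h1.1, hR⟩, hFR⟩
  calc _ ≤ ∑ R ∈ (Icc 1 n).powersetCard m, #(reach t N i R) :=
        (card_le_card hsub).trans card_biUnion_le
    _ ≤ ∑ R ∈ (Icc 1 n).powersetCard m, (2 ^ (m + i) * C) ^ i := by
      refine sum_le_sum fun R hR => ?_
      have := card_reach_le (t := t) hN i R
      rwa [(mem_powersetCard.1 hR).2] at this
    _ = n.choose m * (2 ^ (m + i) * C) ^ i := by simp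
    _ ≤ _ := Nat.mul_le_mul_right _ (Nat.choose_le_pow _ _)

/-- A dense `k`-uniform family with small `t`-meet degrees has a `(t + 1)`-set of positive
relative codegree. -/
lemma exists_codegree_ge {k t : ℕ} (hk : 2 * t + 3 ≤ k) {γ : ℝ} (hγ : 0 < γ) :
    ∃ c > (0 : ℝ), ∃ δ > (0 : ℝ), ∃ n₀ : ℕ, ∀ n ≥ n₀, ∀ G ⊆ (Icc 1 n).powersetCard k,
      γ * n ^ (k - t - 1) ≤ (#G : ℝ) →
      (∀ F ∈ G, (meetDegree t G F : ℝ) < c * n ^ (k - 2 * t - 1)) →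
      ∃ T, #T = t + 1 ∧ δ * n ^ (k - t - 1) ≤ (codegree G T : ℝ) := by
  classical
  obtain ⟨C, hC⟩ : ∃ C : ℕ, C = 2 * k * k := ⟨_, rfl⟩
  obtain ⟨C₁, hC₁⟩ : ∃ C₁ : ℕ, C₁ = (2 ^ (k - t - 2 + (t + 2)) * C) ^ (t + 2) := ⟨_, rfl⟩
  obtain ⟨C₂, hC₂⟩ : ∃ C₂ : ℕ, C₂ = (2 ^ (t + (t + 1)) * C) ^ (t + 1) := ⟨_, rfl⟩
  have hkpos : 0 < k := by omega
  have hCpos : 0 < C := by rw [hC]; positivity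
  have hC₂pos : 0 < C₂ := by rw [hC₂]; positivity
  have hktpos : (0 : ℝ) < ((k - t : ℕ) : ℝ) := by
    have : 0 < k - t := by omega
    exact_mod_cast this
  have hC₂pos' : (0 : ℝ) < C₂ := by exact_mod_cast hC₂pos
  obtain ⟨β, hβ⟩ : ∃ β : ℝ, β = min 1 (γ / (4 * ((k - t : ℕ) : ℝ) * C₂)) := ⟨_, rfl⟩
  have hβ0 : 0 < β := by rw [hβ]; positivity
  have hβ1 : β ≤ 1 := hβ ▸ min_le_left _ _
  have hβγ : ((k - t : ℕ) : ℝ) * C₂ * β ≤ γ / 4 := by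
    have : β ≤ γ / (4 * ((k - t : ℕ) : ℝ) * C₂) := hβ ▸ min_le_right _ _
    rw [le_div_iff₀ (by positivity)] at this
    linarith
  refine ⟨γ / 8, by positivity, (β / 2) ^ (k - t - 1) / (k - t - 1).factorial, by positivity,
    ⌈4 * C₁ / γ⌉₊ + ⌈2 * k / β⌉₊ + 1, ?_⟩
  intro n hn G hG hGc hdeg
  have hn1 : (1 : ℝ) ≤ n := by exact_mod_cast (by omega : 1 ≤ n)
  have hn0 : (0 : ℝ) < n := by linarith
  have hnC₁ : (C₁ : ℝ) ≤ γ / 4 * n := by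
    have h1 : 4 * C₁ / γ ≤ n := Nat.ceil_le.1 (by omega)
    rw [div_le_iff₀ hγ] at h1
    linarith
  have hnβ : 2 * k ≤ β * n := by
    have h1 : 2 * k / β ≤ n := Nat.ceil_le.1 (by omega)
    rw [div_le_iff₀ hβ0] at h1
    linarith
  have hGk : ∀ F ∈ G, F ⊆ Icc 1 n ∧ #F = k := fun F hF => mem_powersetCard.1 (hG hF)
  by_contra! hno
  let N := heavyNeighbors (Icc 1 n) G k
  have hN : ∀ S, #(N S) ≤ C := fun S => hC ▸ card_heavyNeighbors_le (fun F hF => (hGk F hF).2) S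
  let B₁ := G.filter fun F => ∃ S ⊆ F, #S = t ∧ (codegree G S : ℝ) < γ / 4 * n ^ (k - 2 * t - 1)
  let B₂ := G.filter fun F => ∃ R ⊆ F, #R = k - t - 2 ∧ F ∈ reach t N (t + 2) R
  have hB₁ : (#B₁ : ℝ) ≤ γ / 4 * n ^ (k - t - 1) := by
    refine (card_filter_exists_codegree_lt_le hG (by positivity)).trans_eq ?_
    have : k - t - 1 = t + (k - 2 * t - 1) := by omega
    rw [this, pow_add]
    ring
  have hB₂ : (#B₂ : ℝ) ≤ γ / 4 * n ^ (k - t - 1) := by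
    have h1 : (#B₂ : ℝ) ≤ n ^ (k - t - 2) * C₁ := by
      have := card_filter_exists_reach_le (t := t) (i := t + 2) (m := k - t - 2) hG hN
      rw [← hC₁] at this
      exact_mod_cast this
    have h2 : k - t - 1 = k - t - 2 + 1 := by omega
    rw [h2, pow_succ]
    calc (#B₂ : ℝ) ≤ n ^ (k - t - 2) * C₁ := h1
      _ ≤ n ^ (k - t - 2) * (γ / 4 * n) := by gcongr
      _ = _ := by ring
  let G₂ := G \ (B₁ ∪ B₂)
  have hG₂G : G₂ ⊆ G := sdiff_subset
  have hG₂c : γ / 2 * n ^ (k - t - 1) ≤ (#G₂ : ℝ) := by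
    have h1 : #G ≤ #G₂ + (#B₁ + #B₂) := by
      have h2 := card_union_le B₁ B₂
      have h3 := le_card_sdiff (B₁ ∪ B₂) G
      have h4 : #G₂ = #(G \ (B₁ ∪ B₂)) := rfl
      omega
    have h2 : (#G : ℝ) ≤ #G₂ + (#B₁ + #B₂) := by exact_mod_cast h1
    linarith
  have hker : ∀ F ∈ G₂, ∃ T ⊆ F, #T = t + 1 ∧
      ∀ S ⊆ F \ T, #S = t → S ∪ T ∈ reach t N (t + 1) S := by
    intro F hF
    obtain ⟨hFG, hFB⟩ := mem_sdiff.1 hF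
    rw [mem_union, not_or] at hFB
    obtain ⟨hFV, hFk⟩ := hGk F hFG
    refine exists_kernel (by omega) ?_ ?_
    · intro S hSF hSt
      refine exists_mem_heavyNeighbors (by omega) hFV hFk hSF hSt ?_
      have h1 : γ / 4 * n ^ (k - 2 * t - 1) ≤ (codegree G S : ℝ) := by
        by_contra! hlt
        exact hFB.1 (mem_filter.2 ⟨hFG, S, hSF, hSt, hlt⟩)
      have h2 := hdeg F hFG
      have h3 : (2 * meetDegree t G F : ℝ) < codegree G S := by linarith
      exact_mod_cast h3
    · intro R hRF hR hreach
      rw [hFk] at hR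
      exact hFB.2 (mem_filter.2 ⟨hFG, R, hRF, hR, hreach⟩)
  choose! τ hτF hτc hτreach using hker
  let q := ⌊β * n⌋₊
  have hqle : (q : ℝ) ≤ β * n := Nat.floor_le (by positivity)
  have hqlt : β * n < q + 1 := Nat.lt_floor_add_one _
  have hkq : k ≤ q := Nat.le_floor (by linarith [(Nat.cast_nonneg k : (0 : ℝ) ≤ k)])
  have hqn : q ≤ n := by
    have : (q : ℝ) ≤ n := hqle.trans (by nlinarith)
    exact_mod_cast this
  have hchoose : (β / 2) ^ (k - t - 1) / (k - t - 1).factorial * n ^ (k - t - 1) ≤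
      (q.choose (k - t - 1) : ℝ) := by
    refine le_trans ?_ (Nat.pow_le_choose (α := ℝ) (k - t - 1) q)
    rw [div_mul_eq_mul_div, ← mul_pow]
    gcongr
    rw [Nat.cast_sub (by omega)]
    have : ((k - t - 1 : ℕ) : ℝ) ≤ k := by exact_mod_cast (by omega)
    push_cast
    linarith
  have hsmall : ∀ T, #(G₂.filter fun F => τ F = T) ≤ q.choose (k - t - 1) := by
    intro T
    rcases (G₂.filter fun F => τ F = T).eq_empty_or_nonempty with he | ⟨F, hF⟩
    · simp [he]
    obtain ⟨hFG₂, rfl⟩ := mem_filter.1 hF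
    have h1 : #(G₂.filter fun F' => τ F' = τ F) ≤ codegree G (τ F) := by
      refine card_le_card fun F' hF' => ?_
      obtain ⟨hF'G, hF'τ⟩ := mem_filter.1 hF'
      exact mem_filter.2 ⟨hG₂G hF'G, hF'τ ▸ hτF F' hF'G⟩
    have h2 := (hno (τ F) (hτc F hFG₂)).le.trans hchoose
    exact h1.trans (by exact_mod_cast h2)
  have hfew : ∀ S, #S = t →
      #((G₂.image τ).filter fun T => ∃ F ∈ G₂, τ F = T ∧ S ⊆ F \ T) ≤ C₂ := by
    intro S hSt
    have hsub : ((G₂.image τ).filter fun T => ∃ F ∈ G₂, τ F = T ∧ S ⊆ F \ T) ⊆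
        (reach t N (t + 1) S).image (· \ S) := by
      intro T hT
      obtain ⟨-, F, hF, rfl, hS⟩ := mem_filter.1 hT
      refine mem_image.2 ⟨S ∪ τ F, hτreach F hF S hS hSt, ?_⟩
      refine union_sdiff_cancel_left ?_
      rw [disjoint_left]
      exact fun x hx => (mem_sdiff.1 (hS hx)).2
    refine (card_le_card hsub).trans (card_image_le.trans ?_)
    have := card_reach_le (t := t) hN (t + 1) S
    rwa [hSt, ← hC₂] at this
  have hfinal := card_le_of_kernel (by omega) (by omega) hqn (hG₂G.trans hG) τ
    (fun F hF => ⟨hτF F hF, hτc F hF⟩) hfew hsmall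
  have hfinal' : (#G₂ : ℝ) ≤ ((k - t : ℕ) : ℝ) * q ^ (k - 2 * t - 1) * (C₂ * n ^ t) := by
    exact_mod_cast hfinal
  have hqpow : (q : ℝ) ^ (k - 2 * t - 1) ≤ β * n ^ (k - 2 * t - 1) := by
    calc (q : ℝ) ^ (k - 2 * t - 1) ≤ (β * n) ^ (k - 2 * t - 1) := by gcongr
      _ = β ^ (k - 2 * t - 1) * n ^ (k - 2 * t - 1) := mul_pow _ _ _
      _ ≤ β * n ^ (k - 2 * t - 1) := by
        gcongr
        exact pow_le_of_le_one hβ0.le hβ1 (by omega)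
  have hlast : (#G₂ : ℝ) ≤ γ / 4 * n ^ (k - t - 1) := by
    have hexp : k - t - 1 = k - 2 * t - 1 + t := by omega
    calc (#G₂ : ℝ) ≤ ((k - t : ℕ) : ℝ) * q ^ (k - 2 * t - 1) * (C₂ * n ^ t) := hfinal'
      _ ≤ ((k - t : ℕ) : ℝ) * (β * n ^ (k - 2 * t - 1)) * (C₂ * n ^ t) := by gcongr
      _ = (((k - t : ℕ) : ℝ) * C₂ * β) * n ^ (k - t - 1) := by rw [hexp, pow_add]; ring
      _ ≤ γ / 4 * n ^ (k - t - 1) := by gcongr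
  have : 0 < γ * (n : ℝ) ^ (k - t - 1) := by positivity
  linarith

lemma codegree_le_pow {n k : ℕ} {G : Finset (Finset ℕ)} (hG : G ⊆ (Icc 1 n).powersetCard k)
    (S : Finset ℕ) : codegree G S ≤ n ^ (k - #S) := by
  have h1 : codegree G S ≤ #((Icc 1 n).powersetCard (k - #S)) := by
    refine card_le_card_of_injOn (· \ S) ?_ ?_
    · intro F hF
      obtain ⟨hFG, hSF⟩ := mem_filter.1 (mem_coe.1 hF)
      obtain ⟨hFV, hFk⟩ := mem_powersetCard.1 (hG hFG)
      refine mem_coe.2 (mem_powersetCard.2 ⟨sdiff_subset.trans hFV, ?_⟩)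
      rw [card_sdiff_of_subset hSF, hFk]
    · intro F hF F' hF' h
      have h1 := (mem_filter.1 (mem_coe.1 hF)).2
      have h2 := (mem_filter.1 (mem_coe.1 hF')).2
      rw [← sdiff_union_of_subset h1, ← sdiff_union_of_subset h2]
      exact congrArg (· ∪ S) h
  refine h1.trans ?_
  rw [card_powersetCard, Nat.card_Icc, Nat.add_sub_cancel]
  exact Nat.choose_le_pow _ _

/-- The link of `T` in `G`. -/
def link {α : Type*} [DecidableEq α] (G : Finset (Finset α)) (T : Finset α) :
    Finset (Finset α) :=
  (G.filter fun F => T ⊆ F).image (· \ T)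

lemma card_link {α : Type*} [DecidableEq α] (G : Finset (Finset α)) (T : Finset α) :
    #(link G T) = codegree G T := by
  refine card_image_of_injOn ?_
  intro F hF F' hF' h
  have h1 := (mem_filter.1 (mem_coe.1 hF)).2
  have h2 := (mem_filter.1 (mem_coe.1 hF')).2
  rw [← sdiff_union_of_subset h1, ← sdiff_union_of_subset h2]
  exact congrArg (· ∪ T) h

lemma mem_link {α : Type*} [DecidableEq α] {G : Finset (Finset α)} {T B : Finset α} :
    B ∈ link G T ↔ Disjoint B T ∧ T ∪ B ∈ G := by
  simp only [link, mem_image, mem_filter]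
  constructor
  · rintro ⟨F, ⟨hF, hTF⟩, rfl⟩
    exact ⟨sdiff_disjoint, by rwa [union_sdiff_of_subset hTF]⟩
  · rintro ⟨h1, h2⟩
    exact ⟨T ∪ B, ⟨h2, subset_union_left⟩, union_sdiff_cancel_left h1.symm⟩

lemma link_subset_powersetCard {n k t : ℕ} {G : Finset (Finset ℕ)}
    (hG : G ⊆ (Icc 1 n).powersetCard k) {T : Finset ℕ} (hT : #T = t + 1) :
    link G T ⊆ (Icc 1 n).powersetCard (k - t - 1) := by
  intro B hB
  obtain ⟨h1, h2⟩ := mem_link.1 hB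
  obtain ⟨h3, h4⟩ := mem_powersetCard.1 (hG h2)
  rw [card_union_of_disjoint h1.symm] at h4
  exact mem_powersetCard.2 ⟨subset_union_right.trans h3, by omega⟩

lemma meetDegree_inter_link_le {α : Type*} [DecidableEq α] {t a : ℕ} {G : Finset (Finset α)}
    {T₁ T₂ B : Finset α} (ha : #(T₁ ∩ T₂) + a = t) (hB : B ∈ link G T₁ ∩ link G T₂) :
    meetDegree a (link G T₁ ∩ link G T₂) B ≤ meetDegree t G (T₁ ∪ B) := by
  refine card_le_card_of_injOn (T₂ ∪ ·) ?_ ?_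
  · intro B' hB'
    obtain ⟨hB'L, hBB'⟩ := mem_filter.1 (mem_coe.1 hB')
    obtain ⟨h1, h2⟩ := mem_inter.1 hB
    obtain ⟨h3, h4⟩ := mem_inter.1 hB'L
    refine mem_coe.2 (mem_filter.2 ⟨(mem_link.1 h4).2, ?_⟩)
    have d1 := disjoint_left.1 (mem_link.1 h2).1
    have d2 := disjoint_left.1 (mem_link.1 h3).1
    have d3 := disjoint_left.1 (mem_link.1 h1).1
    have heq : (T₁ ∪ B) ∩ (T₂ ∪ B') = (T₁ ∩ T₂) ∪ (B ∩ B') := by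
      ext x
      have e1 := @d1 x
      have e2 := @d2 x
      simp only [mem_inter, mem_union]
      tauto
    have hd : Disjoint (T₁ ∩ T₂) (B ∩ B') := by
      rw [disjoint_left]
      exact fun x hx hx' => d3 (mem_inter.1 hx').1 (mem_inter.1 hx).1
    rw [heq, card_union_of_disjoint hd, hBB', ha]
  · intro B' hB' B'' hB'' h
    have h1 := (mem_link.1 (mem_inter.1 (mem_filter.1 (mem_coe.1 hB')).1).2).1
    have h2 := (mem_link.1 (mem_inter.1 (mem_filter.1 (mem_coe.1 hB'')).1).2).1
    rw [← union_sdiff_cancel_left h1.symm, ← union_sdiff_cancel_left h2.symm]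
    exact congrArg (· \ T₂) h

/-- If all `t`-meet degrees are small then two distinct `(t + 1)`-sets have almost disjoint
links. -/
lemma card_inter_link_le {n k t : ℕ} (hk : 2 * t + 3 ≤ k) {G : Finset (Finset ℕ)}
    (hG : G ⊆ (Icc 1 n).powersetCard k) {ε : ℝ} (hε : 0 < ε) (hn : 1 ≤ n) (hnε : 2 * k ≤ ε * n)
    (hdeg : ∀ F ∈ G, (meetDegree t G F : ℝ) < ε / 2 * n ^ (k - 2 * t - 1))
    {T₁ T₂ : Finset ℕ} (h₁ : #T₁ = t + 1) (h₂ : #T₂ = t + 1) (hne : T₁ ≠ T₂) :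
    (#(link G T₁ ∩ link G T₂) : ℝ) ≤ ε * n ^ (k - t - 1) := by
  by_contra! hlt
  have hn1 : (1 : ℝ) ≤ n := by exact_mod_cast hn
  obtain ⟨ℬ, hℬ⟩ : ∃ ℬ, ℬ = link G T₁ ∩ link G T₂ := ⟨_, rfl⟩
  rw [← hℬ] at hlt
  have hℬV : ℬ ⊆ (Icc 1 n).powersetCard (k - t - 1) :=
    hℬ ▸ inter_subset_left.trans (link_subset_powersetCard hG h₁)
  have hj : #(T₁ ∩ T₂) ≤ t := by
    by_contra! h
    have e1 : T₁ ∩ T₂ = T₁ := eq_of_subset_of_card_le inter_subset_left (by omega)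
    have e2 : T₁ ∩ T₂ = T₂ := eq_of_subset_of_card_le inter_subset_right (by omega)
    exact hne (e1.symm.trans e2)
  obtain ⟨a, ha⟩ := Nat.exists_eq_add_of_le hj
  obtain ⟨B, hB, hBcod⟩ : ∃ B ∈ ℬ, ∀ A ⊆ B, #A = a →
      ε * n ^ (k - t - 1 - a) ≤ (codegree ℬ A : ℝ) := by
    by_contra! hno
    have h1 := card_filter_exists_codegree_lt_le (m := a) hℬV
      (D := ε * n ^ (k - t - 1 - a)) (by positivity)
    have h2 : (ℬ.filter fun F => ∃ S ⊆ F, #S = a ∧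
        (codegree ℬ S : ℝ) < ε * n ^ (k - t - 1 - a)) = ℬ := filter_true_of_mem hno
    rw [h2] at h1
    have h3 : k - t - 1 = a + (k - t - 1 - a) := by omega
    have h4 : (n : ℝ) ^ a * (ε * n ^ (k - t - 1 - a)) = ε * n ^ (k - t - 1) := by
      conv_rhs => rw [h3, pow_add]
      ring
    linarith
  obtain ⟨hBV, hBc⟩ := mem_powersetCard.1 (hℬV hB)
  obtain ⟨A, hAB, hA⟩ := exists_subset_card_eq (show a ≤ #B by omega)
  have hsplit := codegree_le_meetDegree_add_sum (G := ℬ) hAB hA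
  have hmeet : meetDegree a ℬ B ≤ meetDegree t G (T₁ ∪ B) := by
    rw [hℬ]
    exact meetDegree_inter_link_le ha.symm (hℬ ▸ hB)
  have hBG : T₁ ∪ B ∈ G := (mem_link.1 (mem_inter.1 (hℬ ▸ hB)).1).2
  have hsum : ∑ x ∈ B \ A, codegree ℬ (insert x A) ≤ k * n ^ (k - t - 1 - a - 1) := by
    calc _ ≤ ∑ x ∈ B \ A, n ^ (k - t - 1 - a - 1) := by
          refine sum_le_sum fun x hx => ?_
          have := codegree_le_pow hℬV (insert x A)
          rwa [card_insert_of_notMem (mem_sdiff.1 hx).2, hA, ← Nat.sub_sub] at this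
      _ = #(B \ A) * n ^ (k - t - 1 - a - 1) := by simp
      _ ≤ _ := by
        refine Nat.mul_le_mul_right _ ((card_le_card sdiff_subset).trans ?_)
        omega
  have h1 : (codegree ℬ A : ℝ) ≤ meetDegree t G (T₁ ∪ B) + k * n ^ (k - t - 1 - a - 1) := by
    exact_mod_cast hsplit.trans (Nat.add_le_add hmeet hsum)
  have h2 := hBcod A hAB hA
  have h3 := hdeg _ hBG
  have h4 : (n : ℝ) ^ (k - 2 * t - 1) ≤ n ^ (k - t - 1 - a) :=
    pow_le_pow_right₀ hn1 (by omega)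
  have h5 : (k : ℝ) * n ^ (k - t - 1 - a - 1) ≤ ε / 2 * n ^ (k - t - 1 - a) := by
    have h6 : k - t - 1 - a = k - t - 1 - a - 1 + 1 := by omega
    have h7 : (n : ℝ) ^ (k - t - 1 - a) = n ^ (k - t - 1 - a - 1) * n := by
      conv_lhs => rw [h6, pow_succ]
    rw [h7]
    have h8 : (k : ℝ) ≤ ε / 2 * n := by linarith
    calc (k : ℝ) * n ^ (k - t - 1 - a - 1) ≤ (ε / 2 * n) * n ^ (k - t - 1 - a - 1) := by gcongr
      _ = _ := by ring
  have h6 : ε / 2 * (n : ℝ) ^ (k - 2 * t - 1) ≤ ε / 2 * n ^ (k - t - 1 - a) := by gcongr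
  linarith

lemma sum_card_le_card_biUnion_add {ι α : Type*} [DecidableEq ι] [DecidableEq α] (s : Finset ι)
    (A : ι → Finset α) {η : ℝ} (hη : 0 ≤ η)
    (h : ∀ i ∈ s, ∀ j ∈ s, i ≠ j → (#(A i ∩ A j) : ℝ) ≤ η) :
    (∑ i ∈ s, (#(A i) : ℝ)) ≤ #(s.biUnion A) + (#s : ℝ) ^ 2 * η := by
  induction s using Finset.induction_on with
  | empty => simp
  | insert i s hi ih =>
    have ih' := ih fun i' hi' j hj => h i' (mem_insert_of_mem hi') j (mem_insert_of_mem hj)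
    rw [sum_insert hi, biUnion_insert, card_insert_of_notMem hi]
    have h1 : (#(A i ∪ s.biUnion A) : ℝ) + #(A i ∩ s.biUnion A) = #(A i) + #(s.biUnion A) := by
      exact_mod_cast card_union_add_card_inter _ _
    have h2 : (#(A i ∩ s.biUnion A) : ℝ) ≤ #s * η := by
      have h3 : #(A i ∩ s.biUnion A) ≤ ∑ j ∈ s, #(A i ∩ A j) := by
        rw [inter_biUnion]
        exact card_biUnion_le
      calc (#(A i ∩ s.biUnion A) : ℝ) ≤ ∑ j ∈ s, (#(A i ∩ A j) : ℝ) := by exact_mod_cast h3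
        _ ≤ ∑ j ∈ s, η := by
          refine sum_le_sum fun j hj => h i (mem_insert_self _ _) j (mem_insert_of_mem hj) ?_
          rintro rfl
          exact hi hj
        _ = #s * η := by simp
    push_cast
    nlinarith [mul_nonneg (Nat.cast_nonneg #s : (0 : ℝ) ≤ #s) hη]

lemma choose_add_le (m j r : ℕ) (hr : 1 ≤ r) :
    (m + j).choose r ≤ m.choose r + j * (m + j) ^ (r - 1) := by
  obtain ⟨r, rfl⟩ := Nat.exists_eq_add_of_le' hr
  induction j with
  | zero => simp
  | succ j ih =>
    rw [← add_assoc, Nat.choose_succ_succ']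
    have h1 : (m + j).choose r ≤ (m + j + 1) ^ r :=
      (Nat.choose_le_pow _ _).trans (Nat.pow_le_pow_left (Nat.le_succ _) _)
    have h2 : (m + j) ^ r ≤ (m + j + 1) ^ r := Nat.pow_le_pow_left (Nat.le_succ _) _
    have h3 := Nat.mul_le_mul_left j h2
    simp only [Nat.add_sub_cancel] at ih ⊢
    rw [add_mul, one_mul]
    omega

lemma sum_codegree_le {α : Type*} [DecidableEq α] {k : ℕ} {G : Finset (Finset α)}
    (hG : ∀ F ∈ G, #F = k) (𝒯 : Finset (Finset α)) : ∑ T ∈ 𝒯, codegree G T ≤ 2 ^ k * #G := by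
  simp_rw [codegree, card_filter]
  rw [sum_comm]
  calc _ ≤ ∑ F ∈ G, 2 ^ k := by
        refine sum_le_sum fun F hF => ?_
        rw [← card_filter, ← hG F hF, ← card_powerset]
        exact card_le_card fun T hT => mem_powerset.2 (mem_filter.1 hT).2
    _ = _ := by simp [mul_comm]

/-- A robust form of the Frankl–Füredi theorem on families with one forbidden intersection. -/
lemma card_le_of_meetDegree_lt {k t : ℕ} (hk : 2 * t + 3 ≤ k) {ε M : ℝ} (hε : 0 < ε)
    (hM : 0 < M) :
    ∃ c > (0 : ℝ), ∃ n₀ : ℕ, ∀ n ≥ n₀, ∀ G ⊆ (Icc 1 n).powersetCard k,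
      (#G : ℝ) ≤ M * n ^ (k - t - 1) →
      (∀ F ∈ G, (meetDegree t G F : ℝ) < c * n ^ (k - 2 * t - 1)) →
      (#G : ℝ) ≤ (n - t - 1).choose (k - t - 1) + ε * n ^ (k - t - 1) := by
  classical
  obtain ⟨c, hc, δ, hδ, n₁, hstar⟩ := exists_codegree_ge hk (γ := ε / 4) (by positivity)
  obtain ⟨K, hK⟩ : ∃ K : ℝ, K = 2 ^ k * M / δ := ⟨_, rfl⟩
  have hKpos : 0 < K := by rw [hK]; positivity
  obtain ⟨η, hη⟩ : ∃ η : ℝ, η = ε / (4 * K ^ 2) := ⟨_, rfl⟩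
  have hηpos : 0 < η := by rw [hη]; positivity
  refine ⟨min c (η / 2), by positivity, n₁ + ⌈4 * (t + 1) / ε⌉₊ + ⌈2 * k / η⌉₊ + k, ?_⟩
  intro n hn G hG hGM hdeg
  have hn1' : 1 ≤ n := by omega
  have hn1 : (1 : ℝ) ≤ n := by exact_mod_cast hn1'
  have hnpow : (0 : ℝ) < (n : ℝ) ^ (k - t - 1) := by positivity
  have hnt : (t + 1 : ℝ) ≤ ε / 4 * n := by
    have h1 : 4 * (t + 1) / ε ≤ n := Nat.ceil_le.1 (by omega)
    rw [div_le_iff₀ hε] at h1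
    linarith
  have hnη : 2 * k ≤ η * n := by
    have h1 : 2 * k / η ≤ n := Nat.ceil_le.1 (by omega)
    rw [div_le_iff₀ hηpos] at h1
    linarith
  have hGk : ∀ F ∈ G, F ⊆ Icc 1 n ∧ #F = k := fun F hF => mem_powersetCard.1 (hG hF)
  let 𝒯 := ((Icc 1 n).powersetCard (t + 1)).filter
    fun T => δ * n ^ (k - t - 1) ≤ (codegree G T : ℝ)
  have h𝒯c : ∀ T ∈ 𝒯, #T = t + 1 := fun T hT => (mem_powersetCard.1 (mem_filter.1 hT).1).2
  have h𝒯K : (#𝒯 : ℝ) ≤ K := by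
    have h1 : (∑ T ∈ 𝒯, (codegree G T : ℝ)) ≤ 2 ^ k * #G := by
      exact_mod_cast sum_codegree_le (fun F hF => (hGk F hF).2) 𝒯
    have h2 : #𝒯 * (δ * n ^ (k - t - 1)) ≤ ∑ T ∈ 𝒯, (codegree G T : ℝ) := by
      calc #𝒯 * (δ * (n : ℝ) ^ (k - t - 1)) = ∑ T ∈ 𝒯, δ * (n : ℝ) ^ (k - t - 1) := by simp
        _ ≤ _ := sum_le_sum fun T hT => (mem_filter.1 hT).2
    have h3 : (2 : ℝ) ^ k * #G ≤ 2 ^ k * (M * n ^ (k - t - 1)) := by gcongr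
    rw [hK, le_div_iff₀ hδ]
    refine le_of_mul_le_mul_right ?_ hnpow
    linarith
  let G₀ := G.filter fun F => ∀ T ∈ 𝒯, ¬ T ⊆ F
  have hG₀ : (#G₀ : ℝ) ≤ ε / 4 * n ^ (k - t - 1) := by
    by_contra! hlt
    have hG₀G : G₀ ⊆ G := filter_subset _ _
    have hdeg₀ : ∀ F ∈ G₀, (meetDegree t G₀ F : ℝ) < c * n ^ (k - 2 * t - 1) := by
      intro F hF
      have h1 := hdeg F (hG₀G hF)
      have h2 : (meetDegree t G₀ F : ℝ) ≤ meetDegree t G F := by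
        exact_mod_cast meetDegree_mono hG₀G F
      have h3 : min c (η / 2) * (n : ℝ) ^ (k - 2 * t - 1) ≤ c * n ^ (k - 2 * t - 1) := by
        gcongr
        exact min_le_left _ _
      linarith
    obtain ⟨T, hTc, hT⟩ := hstar n (by omega) G₀ (hG₀G.trans hG) hlt.le hdeg₀
    have hpos : 0 < codegree G₀ T := by
      have : (0 : ℝ) < codegree G₀ T := lt_of_lt_of_le (by positivity) hT
      exact_mod_cast this
    obtain ⟨F, hF⟩ := card_pos.1 hpos
    obtain ⟨hFG₀, hTF⟩ := mem_filter.1 hF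
    refine (mem_filter.1 hFG₀).2 T (mem_filter.2 ⟨?_, ?_⟩) hTF
    · exact mem_powersetCard.2 ⟨hTF.trans (hGk F (hG₀G hFG₀)).1, hTc⟩
    · exact hT.trans (by exact_mod_cast codegree_mono hG₀G T)
  have hGsplit : #G ≤ #G₀ + ∑ T ∈ 𝒯, #(link G T) := by
    have hsub : G ⊆ G₀ ∪ 𝒯.biUnion fun T => G.filter fun F => T ⊆ F := by
      intro F hF
      by_cases hF₀ : F ∈ G₀
      · exact mem_union_left _ hF₀
      · have : ∃ T ∈ 𝒯, T ⊆ F := by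
          by_contra! hno
          exact hF₀ (mem_filter.2 ⟨hF, hno⟩)
        obtain ⟨T, hT, hTF⟩ := this
        exact mem_union_right _ (mem_biUnion.2 ⟨T, hT, mem_filter.2 ⟨hF, hTF⟩⟩)
    refine (card_le_card hsub).trans ((card_union_le _ _).trans (Nat.add_le_add_left ?_ _))
    refine card_biUnion_le.trans (sum_le_sum fun T _ => ?_)
    rw [card_link]
    exact le_rfl
  have hlinks := sum_card_le_card_biUnion_add 𝒯 (link G) (η := η * n ^ (k - t - 1))
    (by positivity) (by
      intro T₁ h₁ T₂ h₂ hne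
      refine card_inter_link_le hk hG hηpos hn1' hnη ?_ (h𝒯c _ h₁) (h𝒯c _ h₂) hne
      intro F hF
      refine (hdeg F hF).trans_le ?_
      gcongr
      exact min_le_right _ _)
  have hunion : #(𝒯.biUnion (link G)) ≤ n.choose (k - t - 1) := by
    have hsub : 𝒯.biUnion (link G) ⊆ (Icc 1 n).powersetCard (k - t - 1) :=
      biUnion_subset.2 fun T hT => link_subset_powersetCard hG (h𝒯c T hT)
    simpa using card_le_card hsub
  have hchoose : (n.choose (k - t - 1) : ℝ) ≤
      (n - t - 1).choose (k - t - 1) + ε / 4 * n ^ (k - t - 1) := by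
    have h1 := choose_add_le (n - t - 1) (t + 1) (k - t - 1) (by omega)
    have h2 : n - t - 1 + (t + 1) = n := by omega
    rw [h2] at h1
    have h3 : (n.choose (k - t - 1) : ℝ) ≤
        (n - t - 1).choose (k - t - 1) + (t + 1) * n ^ (k - t - 1 - 1) := by exact_mod_cast h1
    have h4 : k - t - 1 = k - t - 1 - 1 + 1 := by omega
    have h5 : (n : ℝ) ^ (k - t - 1) = n ^ (k - t - 1 - 1) * n := by
      conv_lhs => rw [h4, pow_succ]
    have h6 : (t + 1 : ℝ) * n ^ (k - t - 1 - 1) ≤ ε / 4 * n ^ (k - t - 1) := by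
      rw [h5]
      calc (t + 1 : ℝ) * n ^ (k - t - 1 - 1) ≤ (ε / 4 * n) * n ^ (k - t - 1 - 1) := by gcongr
        _ = _ := by ring
    linarith
  have hsq : (#𝒯 : ℝ) ^ 2 * (η * n ^ (k - t - 1)) ≤ ε / 4 * n ^ (k - t - 1) := by
    calc (#𝒯 : ℝ) ^ 2 * (η * n ^ (k - t - 1)) ≤ K ^ 2 * (η * n ^ (k - t - 1)) := by gcongr
      _ = _ := by rw [hη]; field_simp
  have h1 : (#G : ℝ) ≤ #G₀ + ∑ T ∈ 𝒯, (#(link G T) : ℝ) := by exact_mod_cast hGsplit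
  have h2 : (#(𝒯.biUnion (link G)) : ℝ) ≤ n.choose (k - t - 1) := by exact_mod_cast hunion
  have h3 : 0 < ε * (n : ℝ) ^ (k - t - 1) := by positivity
  linarith

lemma rhoPairs_erase_add_meetDegree_le {k t : ℕ} (htk : t < k) {G : Finset (Finset ℕ)}
    {F : Finset ℕ} (hF : F ∈ G) (hFk : #F = k) :
    rhoPairs t (G.erase F) + meetDegree t G F ≤ rhoPairs t G := by
  classical
  have hne : ∀ F' ∈ G.filter (fun F' => #(F ∩ F') = t), F' ≠ F := by
    rintro F' hF' rfl
    have := (mem_filter.1 hF').2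
    rw [inter_self] at this
    omega
  have himage : #((G.filter fun F' => #(F ∩ F') = t).image fun F' => ({F, F'} : Finset _)) =
      meetDegree t G F := by
    refine card_image_of_injOn ?_
    intro A hA B hB hAB
    have h1 : A ∈ ({F, B} : Finset (Finset ℕ)) := by
      rw [← show ({F, A} : Finset (Finset ℕ)) = {F, B} from hAB]
      simp
    rw [mem_insert, mem_singleton] at h1
    exact h1.resolve_left (hne A (mem_coe.1 hA))
  rw [← himage, rhoPairs, rhoPairs, ← card_union_of_disjoint]
  · refine card_le_card ?_
    intro P hP
    rcases mem_union.1 hP with hP | hP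
    · obtain ⟨h1, h2⟩ := mem_filter.1 hP
      exact mem_filter.2 ⟨powersetCard_mono (erase_subset _ _) h1, h2⟩
    · obtain ⟨F', hF', rfl⟩ := mem_image.1 hP
      obtain ⟨h1, h2⟩ := mem_filter.1 hF'
      refine mem_filter.2 ⟨mem_powersetCard.2 ⟨?_, card_pair (hne F' hF').symm⟩, ?_⟩
      · exact insert_subset hF (singleton_subset_iff.2 h1)
      · exact ⟨F, by simp, F', by simp, (hne F' hF').symm, h2⟩
  · rw [disjoint_left]
    intro P hP hP'
    obtain ⟨F', -, rfl⟩ := mem_image.1 hP'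
    have := (mem_powersetCard.1 (mem_filter.1 hP).1).1 (mem_insert_self F _)
    simp at this

/-- If every large subfamily has a member of large meet degree, then there are many pairs. -/
lemma mul_le_rhoPairs {k t : ℕ} (htk : t < k) {M D : ℝ} (hD : 0 ≤ D) (G : Finset (Finset ℕ))
    (hG : ∀ F ∈ G, #F = k)
    (h : ∀ G' ⊆ G, M < #G' → ∃ F ∈ G', D ≤ (meetDegree t G' F : ℝ)) :
    (#G - M) * D ≤ (rhoPairs t G : ℝ) := by
  induction hm : #G generalizing G with
  | zero =>
    by_cases hM : M < 0
    · obtain ⟨F, hF, -⟩ := h G Subset.rfl (by rw [hm]; exact_mod_cast hM)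
      rw [card_eq_zero.1 hm] at hF
      simp at hF
    · have : (((0 : ℕ) : ℝ) - M) * D ≤ 0 :=
        mul_nonpos_of_nonpos_of_nonneg (by push_cast; linarith) hD
      exact this.trans (Nat.cast_nonneg _)
  | succ m ih =>
    by_cases hM : M < (#G : ℝ)
    · obtain ⟨F, hF, hFD⟩ := h G Subset.rfl hM
      have h1 := ih (G.erase F) (fun F' hF' => hG F' (mem_of_mem_erase hF'))
        (fun G' hG' => h G' (hG'.trans (erase_subset _ _))) (by rw [card_erase_of_mem hF, hm]; rfl)
      have h2 : (rhoPairs t (G.erase F) : ℝ) + meetDegree t G F ≤ rhoPairs t G := by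
        exact_mod_cast rhoPairs_erase_add_meetDegree_le htk hF (hG F hF)
      push_cast
      linarith
    · rw [hm] at hM
      exact (mul_nonpos_of_nonpos_of_nonneg (by linarith) hD).trans (Nat.cast_nonneg _)

/-- Families covered by the stars of `m` disjoint `(t + 1)`-sets have few pairs. -/
lemma rhoPairs_le_of_stars {n k t m : ℕ} {G : Finset (Finset ℕ)}
    (hG : G ⊆ (Icc 1 n).powersetCard k) (T : ℕ → Finset ℕ) (hTc : ∀ i, #(T i) = t + 1)
    (hTd : ∀ i j, i ≠ j → Disjoint (T i) (T j)) (hcov : ∀ F ∈ G, ∃ i < m, T i ⊆ F) :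
    rhoPairs t G ≤ m ^ 2 * 2 ^ 2 ^ (2 * k - t) * n ^ (2 * k - 3 * t - 2) := by
  classical
  let 𝒰 : ℕ × ℕ → Finset (Finset ℕ) := fun p =>
    ((Icc 1 n).powersetCard (2 * k - t)).filter fun U => T p.1 ∪ T p.2 ⊆ U
  have hsub : (G.powersetCard 2).filter (fun P => ∃ A ∈ P, ∃ B ∈ P, A ≠ B ∧ #(A ∩ B) = t) ⊆
      (range m).offDiag.biUnion fun p => (𝒰 p).biUnion fun U => U.powerset.powerset := by
    intro P hP
    obtain ⟨hPG, A, hA, B, hB, hAB, hABt⟩ := mem_filter.1 hP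
    obtain ⟨hPG, hP2⟩ := mem_powersetCard.1 hPG
    have hPeq : ({A, B} : Finset (Finset ℕ)) = P := by
      refine eq_of_subset_of_card_le (insert_subset hA (singleton_subset_iff.2 hB)) ?_
      rw [hP2, card_pair hAB]
    obtain ⟨hAV, hAk⟩ := mem_powersetCard.1 (hG (hPG hA))
    obtain ⟨hBV, hBk⟩ := mem_powersetCard.1 (hG (hPG hB))
    obtain ⟨i, hi, hiA⟩ := hcov A (hPG hA)
    obtain ⟨j, hj, hjB⟩ := hcov B (hPG hB)
    have hij : i ≠ j := by
      rintro rfl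
      have := card_le_card (subset_inter hiA hjB)
      rw [hTc, hABt] at this
      omega
    have hU : #(A ∪ B) = 2 * k - t := by
      have := card_union_add_card_inter A B
      omega
    refine mem_biUnion.2 ⟨(i, j), mem_offDiag.2 ⟨mem_range.2 hi, mem_range.2 hj, hij⟩, ?_⟩
    refine mem_biUnion.2 ⟨A ∪ B, mem_filter.2 ⟨?_, union_subset_union hiA hjB⟩, ?_⟩
    · exact mem_powersetCard.2 ⟨union_subset hAV hBV, hU⟩
    · rw [mem_powerset, ← hPeq]
      refine insert_subset (mem_powerset.2 subset_union_left) (singleton_subset_iff.2 ?_)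
      exact mem_powerset.2 subset_union_right
  have h𝒰 : ∀ p ∈ (range m).offDiag, #(𝒰 p) ≤ n ^ (2 * k - 3 * t - 2) := by
    intro p hp
    have hne := (mem_offDiag.1 hp).2.2
    have h1 := codegree_le_pow (Subset.refl ((Icc 1 n).powersetCard (2 * k - t)))
      (T p.1 ∪ T p.2)
    rw [card_union_of_disjoint (hTd _ _ hne), hTc, hTc] at h1
    have h2 : 2 * k - t - (t + 1 + (t + 1)) = 2 * k - 3 * t - 2 := by omega
    rwa [h2] at h1
  calc rhoPairs t G
      ≤ ∑ p ∈ (range m).offDiag, #((𝒰 p).biUnion fun U => U.powerset.powerset) :=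
        (card_le_card hsub).trans card_biUnion_le
    _ ≤ ∑ p ∈ (range m).offDiag, n ^ (2 * k - 3 * t - 2) * 2 ^ 2 ^ (2 * k - t) := by
      refine sum_le_sum fun p hp => card_biUnion_le.trans ?_
      calc ∑ U ∈ 𝒰 p, #U.powerset.powerset = ∑ U ∈ 𝒰 p, 2 ^ 2 ^ (2 * k - t) := by
            refine sum_congr rfl fun U hU => ?_
            rw [card_powerset, card_powerset, (mem_powersetCard.1 (mem_filter.1 hU).1).2]
        _ = #(𝒰 p) * 2 ^ 2 ^ (2 * k - t) := by rw [sum_const, smul_eq_mul]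
        _ ≤ _ := Nat.mul_le_mul_right _ (h𝒰 p hp)
    _ = #(range m).offDiag * (n ^ (2 * k - 3 * t - 2) * 2 ^ 2 ^ (2 * k - t)) := by
      rw [sum_const, smul_eq_mul]
    _ ≤ m ^ 2 * (n ^ (2 * k - 3 * t - 2) * 2 ^ 2 ^ (2 * k - t)) := by
      refine Nat.mul_le_mul_right _ ?_
      rw [offDiag_card, card_range, sq]
      exact Nat.sub_le _ _
    _ = _ := by ring

/-- Lower bound for the size of the union of the stars of `m` disjoint `(t + 1)`-sets. -/
lemma mul_choose_le_card_stars {n k t m : ℕ} (htk : t < k) (hmn : m * (t + 1) ≤ n)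
    (T : ℕ → Finset ℕ) (hTc : ∀ i, #(T i) = t + 1) (hTd : ∀ i j, i ≠ j → Disjoint (T i) (T j))
    (hT : ∀ i < m, T i ⊆ Icc 1 (m * (t + 1))) :
    m * (n - m * (t + 1)).choose (k - t - 1) ≤
      #(((Icc 1 n).powersetCard k).filter fun F => ∃ i < m, T i ⊆ F) := by
  have hdisj : ∀ i < m, ∀ B ∈ (Icc (m * (t + 1) + 1) n).powersetCard (k - t - 1),
      Disjoint (T i) B := by
    intro i hi B hB
    rw [disjoint_left]
    intro x hx hxB
    have h1 := mem_Icc.1 (hT i hi hx)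
    have h2 := mem_Icc.1 ((mem_powersetCard.1 hB).1 hxB)
    omega
  have hcard : m * (n - m * (t + 1)).choose (k - t - 1) =
      #(range m ×ˢ (Icc (m * (t + 1) + 1) n).powersetCard (k - t - 1)) := by
    rw [card_product, card_range, card_powersetCard, Nat.card_Icc, Nat.add_sub_add_right]
  rw [hcard]
  refine card_le_card_of_injOn (fun p => T p.1 ∪ p.2) ?_ ?_
  · rintro ⟨i, B⟩ hp
    obtain ⟨hi, hB⟩ := mem_product.1 (mem_coe.1 hp)
    have hi' : i < m := mem_range.1 hi
    obtain ⟨hBV, hBc⟩ := mem_powersetCard.1 hB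
    refine mem_coe.2 (mem_filter.2 ⟨mem_powersetCard.2 ⟨union_subset ?_ ?_, ?_⟩, ?_⟩)
    · exact (hT i hi').trans (Icc_subset_Icc_right hmn)
    · exact hBV.trans (Icc_subset_Icc_left (by omega))
    · rw [card_union_of_disjoint (hdisj i hi' B hB), hTc, hBc]
      omega
    · exact ⟨i, hi', subset_union_left⟩
  · rintro ⟨i, B⟩ hp ⟨j, B'⟩ hp' heq
    obtain ⟨hi, hB⟩ := mem_product.1 (mem_coe.1 hp)
    obtain ⟨hj, hB'⟩ := mem_product.1 (mem_coe.1 hp')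
    have hdB := hdisj i (mem_range.1 hi) B hB
    have hdB' := hdisj i (mem_range.1 hi) B' hB'
    have heq' : T i ∪ B = T j ∪ B' := heq
    have hij : i = j := by
      by_contra hne
      obtain ⟨x, hx⟩ : (T i).Nonempty := card_pos.1 (by rw [hTc]; omega)
      have h1 : x ∈ T j ∪ B' := heq' ▸ mem_union_left _ hx
      rcases mem_union.1 h1 with h1 | h1
      · exact disjoint_left.1 (hTd i j hne) hx h1
      · exact disjoint_left.1 hdB' hx h1
    subst hij
    have : B = B' := by
      rw [← union_sdiff_cancel_left hdB, ← union_sdiff_cancel_left hdB', heq']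
    rw [this]

lemma exists_disjoint_blocks (t m : ℕ) : ∃ T : ℕ → Finset ℕ, (∀ i, #(T i) = t + 1) ∧
    (∀ i j, i ≠ j → Disjoint (T i) (T j)) ∧ ∀ i < m, T i ⊆ Icc 1 (m * (t + 1)) := by
  have hle : ∀ i j, i < j → i * (t + 1) + (t + 1) ≤ j * (t + 1) := by
    intro i j hij
    have := Nat.mul_le_mul_right (t + 1) (Nat.succ_le_of_lt hij)
    rwa [Nat.succ_mul] at this
  refine ⟨fun i => Icc (i * (t + 1) + 1) (i * (t + 1) + (t + 1)), ?_, ?_, ?_⟩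
  · intro i
    rw [Nat.card_Icc]
    omega
  · intro i j hij
    rw [disjoint_left]
    intro x hx hx'
    rw [mem_Icc] at hx hx'
    rcases Nat.lt_or_gt_of_ne hij with h | h
    · have := hle i j h
      omega
    · have := hle j i h
      omega
  · intro i hi
    have := hle i m hi
    exact Icc_subset_Icc (by omega) this

/-- Families of size `O(n ^ (k - t - 1))` with few pairs exist. -/
lemma exists_family_rhoPairs_le {k t : ℕ} (htk : t < k) (M : ℝ) :
    ∃ c > (0 : ℝ), ∃ n₀ : ℕ, ∀ n ≥ n₀, ∀ l : ℕ, (l : ℝ) ≤ M * n ^ (k - t - 1) →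
      ∃ G ⊆ (Icc 1 n).powersetCard k, #G = l ∧
        (rhoPairs t G : ℝ) ≤ c * n ^ (2 * k - 3 * t - 2) := by
  obtain ⟨m, hm⟩ : ∃ m : ℕ, M * (2 ^ (k - t - 1) * (k - t - 1).factorial) ≤ m := exists_nat_ge _
  obtain ⟨T, hTc, hTd, hT⟩ := exists_disjoint_blocks t m
  refine ⟨(m : ℝ) ^ 2 * 2 ^ 2 ^ (2 * k - t) + 1, by positivity, 2 * (m * (t + 1) + k), ?_⟩
  intro n hn l hl
  have hstars := mul_choose_le_card_stars htk (n := n) (by omega) T hTc hTd hT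
  have hchoose : ((n : ℝ) / 2) ^ (k - t - 1) / (k - t - 1).factorial ≤
      ((n - m * (t + 1)).choose (k - t - 1) : ℝ) := by
    refine le_trans ?_ (Nat.pow_le_choose (α := ℝ) (k - t - 1) (n - m * (t + 1)))
    gcongr
    rw [div_le_iff₀ (by norm_num)]
    have : n ≤ (n - m * (t + 1) + 1 - (k - t - 1)) * 2 := by omega
    exact_mod_cast this
  have hl' : l ≤ m * (n - m * (t + 1)).choose (k - t - 1) := by
    have h1 : M * (n : ℝ) ^ (k - t - 1) ≤
        m * (((n : ℝ) / 2) ^ (k - t - 1) / (k - t - 1).factorial) := by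
      calc M * (n : ℝ) ^ (k - t - 1) = M * (2 ^ (k - t - 1) * (k - t - 1).factorial) *
            (((n : ℝ) / 2) ^ (k - t - 1) / (k - t - 1).factorial) := by
            rw [div_pow]; field_simp
        _ ≤ _ := by gcongr
    have h2 : (l : ℝ) ≤ m * ((n - m * (t + 1)).choose (k - t - 1) : ℝ) :=
      hl.trans (h1.trans (by gcongr))
    exact_mod_cast h2
  obtain ⟨G, hGsub, hGc⟩ := exists_subset_card_eq (hl'.trans hstars)
  have hGV : G ⊆ (Icc 1 n).powersetCard k := hGsub.trans (filter_subset _ _)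
  refine ⟨G, hGV, hGc, ?_⟩
  have h1 := rhoPairs_le_of_stars hGV T hTc hTd (fun F hF => (mem_filter.1 (hGsub hF)).2)
  have h2 : (rhoPairs t G : ℝ) ≤ (m : ℝ) ^ 2 * 2 ^ 2 ^ (2 * k - t) * n ^ (2 * k - 3 * t - 2) := by
    exact_mod_cast h1
  refine h2.trans ?_
  gcongr
  linarith

/-- Lower bound for the number of pairs in families exceeding the size of a star. -/
lemma exists_mul_pow_le_rhoPairs {k t : ℕ} (hk : 2 * t + 3 ≤ k) {a M : ℝ} (ha : 0 < a)
    (hM : 0 < M) :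
    ∃ c > (0 : ℝ), ∃ n₀ : ℕ, ∀ n ≥ n₀, ∀ G ⊆ (Icc 1 n).powersetCard k,
      (#G : ℝ) ≤ M * n ^ (k - t - 1) →
      ((n - t - 1).choose (k - t - 1) : ℝ) + a * n ^ (k - t - 1) ≤ #G →
      c * n ^ (2 * k - 3 * t - 2) ≤ (rhoPairs t G : ℝ) := by
  obtain ⟨c, hc, n₀, hmain⟩ := card_le_of_meetDegree_lt hk (ε := a / 2) (M := M)
    (by positivity) hM
  refine ⟨a / 2 * c, by positivity, n₀, ?_⟩
  intro n hn G hG hGM hGa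
  have h1 := mul_le_rhoPairs (t := t) (k := k) (by omega)
    (M := (n - t - 1).choose (k - t - 1) + a / 2 * n ^ (k - t - 1))
    (D := c * n ^ (k - 2 * t - 1)) (by positivity) G
    (fun F hF => (mem_powersetCard.1 (hG hF)).2) (by
      intro G' hG' hlt
      by_contra! hno
      have h2 : (#G' : ℝ) ≤ #G := by exact_mod_cast card_le_card hG'
      exact absurd (hmain n hn G' (hG'.trans hG) (h2.trans hGM) hno) (not_le.2 hlt))
  refine le_trans ?_ h1
  have h3 : 2 * k - 3 * t - 2 = (k - t - 1) + (k - 2 * t - 1) := by omega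
  calc a / 2 * c * (n : ℝ) ^ (2 * k - 3 * t - 2)
      = (a / 2 * n ^ (k - t - 1)) * (c * n ^ (k - 2 * t - 1)) := by rw [h3, pow_add]; ring
    _ ≤ _ := by
      gcongr
      linarith

end JohnsonGraph

open JohnsonGraph

/-- Theorem 5 (ii): for `k ≥ 2t+3` and `r = Θ(n^{k-t-1})`,
`ρ(C(n-t-1,k-t-1) + r) = Θ(n^{2k-3t-2})`. -/
theorem rho_thm5_ii (k t : ℕ) (ht : 0 < t) (h : 2 * t + 3 ≤ k)
    (a b : ℝ) (ha : 0 < a) (hab : a ≤ b) :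
    ∀ r : ℕ → ℕ,
      (∃ N : ℕ, ∀ n ≥ N,
        a * (n : ℝ) ^ (k - t - 1) ≤ (r n : ℝ) ∧ (r n : ℝ) ≤ b * (n : ℝ) ^ (k - t - 1)) →
      ∃ c₁ c₂ : ℝ, 0 < c₁ ∧ 0 < c₂ ∧ ∃ n₀ : ℕ, ∀ n > n₀,
        c₁ * (n : ℝ) ^ (2 * k - 3 * t - 2)
            ≤ (rhoMin n k t ((n - t - 1).choose (k - t - 1) + r n) : ℝ) ∧
        (rhoMin n k t ((n - t - 1).choose (k - t - 1) + r n) : ℝ)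
            ≤ c₂ * (n : ℝ) ^ (2 * k - 3 * t - 2) := by
  rintro r ⟨N, hN⟩
  have hb : 0 < b := ha.trans_le hab
  obtain ⟨c₁, hc₁, n₁, hlower⟩ := exists_mul_pow_le_rhoPairs h ha (M := 1 + b) (by positivity)
  obtain ⟨c₂, hc₂, n₂, hupper⟩ := exists_family_rhoPairs_le (k := k) (t := t) (by omega) (1 + b)
  refine ⟨c₁, c₂, hc₁, hc₂, N + n₁ + n₂, ?_⟩
  intro n hn
  obtain ⟨hra, hrb⟩ := hN n (by omega)
  obtain ⟨l, hl⟩ : ∃ l, l = (n - t - 1).choose (k - t - 1) + r n := ⟨_, rfl⟩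
  have hl' : (l : ℝ) = (n - t - 1).choose (k - t - 1) + r n := by exact_mod_cast hl
  have hlM : (l : ℝ) ≤ (1 + b) * n ^ (k - t - 1) := by
    have h1 : (n - t - 1).choose (k - t - 1) ≤ n ^ (k - t - 1) :=
      (Nat.choose_le_pow _ _).trans (Nat.pow_le_pow_left (by omega) _)
    have h2 : ((n - t - 1).choose (k - t - 1) : ℝ) ≤ (n : ℝ) ^ (k - t - 1) := by exact_mod_cast h1
    linarith
  obtain ⟨G, hG, hGc, hGρ⟩ := hupper n (by omega) l hlM
  rw [← hl]
  have hmem : rhoPairs t G ∈ {m : ℕ | ∃ F : Finset (Finset ℕ),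
      F ⊆ (Finset.Icc 1 n).powersetCard k ∧ F.card = l ∧ rhoPairs t F = m} := ⟨G, hG, hGc, rfl⟩
  constructor
  · obtain ⟨F, hF, hFc, hFρ⟩ := Nat.sInf_mem ⟨_, hmem⟩
    have h1 : (rhoMin n k t l : ℝ) = rhoPairs t F := by
      rw [hFρ]
      rfl
    rw [h1]
    refine hlower n (by omega) F hF ?_ ?_
    · rw [hFc]
      exact hlM
    · rw [hFc, hl']
      linarith
  · have h1 : rhoMin n k t l ≤ rhoPairs t G := Nat.sInf_le hmem
    exact le_trans (by exact_mod_cast h1) hGρ
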